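/- arXiv:math/0601773 — 6 statements merged into one kernel-verified Lean document; each statement's English description precedes it below -/
import Mathlib

section
/- Let c_n = (-3/4)^n · Γ(n + 1/6) · Γ(n + 5/6) / (2π · Γ(n + 1)) for n ≥ 1. Then the complex power series Σ_{m≥0} (c_{m+1}/m!) · ξ^m has radius of convergence exactly 4/3. -/
/-- The minor (formal Borel transform) `Σ_{m≥0} (c_{m+1}/m!) ξ^m` of the Airy WKB symbol
has radius of convergence exactly `4/3`: the series is summable for `‖ξ‖ < 4/3` and
not summable for `‖ξ‖ > 4/3`. -/
theorem airy_wkb_minor_radius (c : ℕ → ℂ)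
    (hc : ∀ n : ℕ, 1 ≤ n →
      c n = (-3/4 : ℂ)^n * Complex.Gamma ((n : ℂ) + 1/6) * Complex.Gamma ((n : ℂ) + 5/6) /
        (2 * (Real.pi : ℂ) * Complex.Gamma ((n : ℂ) + 1))) :
    (∀ ξ : ℂ, ‖ξ‖ < 4/3 →
      Summable (fun m : ℕ => c (m + 1) / (m.factorial : ℂ) * ξ^m)) ∧
    (∀ ξ : ℂ, 4/3 < ‖ξ‖ →
      ¬ Summable (fun m : ℕ => c (m + 1) / (m.factorial : ℂ) * ξ^m)) := by
  have hpi : (Real.pi : ℂ) ≠ 0 := by exact_mod_cast Real.pi_ne_zero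
  have hG : ∀ (n : ℕ) (x : ℝ), 0 < x → Complex.Gamma ((n : ℂ) + (x : ℂ)) ≠ 0 := by
    intro n x hx
    apply Complex.Gamma_ne_zero_of_re_pos
    simp
    positivity
  have hx : ∀ (n : ℕ) (x : ℝ), 0 < x → (n : ℂ) + (x : ℂ) ≠ 0 := by
    intro n x hx
    have : (n : ℝ) + x ≠ 0 := by positivity
    exact_mod_cast this
  have h16 := fun n => hG n (1/6) (by norm_num)
  have h56 := fun n => hG n (5/6) (by norm_num)
  have h1 := fun n => hG n 1 (by norm_num)
  have g16 := fun n => hx n (1/6) (by norm_num)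
  have g56 := fun n => hx n (5/6) (by norm_num)
  have g1 := fun n => hx n 1 (by norm_num)
  push_cast at h16 h56 h1 g16 g56 g1
  have hne : ∀ n : ℕ, c (n + 1) ≠ 0 := by
    intro n
    rw [hc (n + 1) (by omega)]
    have := h1 (n + 1)
    refine div_ne_zero (mul_ne_zero (mul_ne_zero (pow_ne_zero _ (by norm_num)) (h16 _)) (h56 _))
      (mul_ne_zero (mul_ne_zero two_ne_zero hpi) (h1 _))
  have hrec : ∀ n : ℕ, 1 ≤ n → c (n + 1) =
      c n * ((-3/4) * ((n : ℂ) + 1/6) * ((n : ℂ) + 5/6) / ((n : ℂ) + 1)) := by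
    intro n hn
    rw [hc (n + 1) (by omega), hc n hn]
    have e1 : ((n + 1 : ℕ) : ℂ) + 1/6 = ((n : ℂ) + 1/6) + 1 := by push_cast; ring
    have e2 : ((n + 1 : ℕ) : ℂ) + 5/6 = ((n : ℂ) + 5/6) + 1 := by push_cast; ring
    have e3 : ((n + 1 : ℕ) : ℂ) + 1 = ((n : ℂ) + 1) + 1 := by push_cast; ring
    rw [e1, e2, e3, Complex.Gamma_add_one _ (g16 n), Complex.Gamma_add_one _ (g56 n),
      Complex.Gamma_add_one _ (g1 n), pow_succ, div_mul_div_comm]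
    congr 1 <;> ring
  have hlim : ∀ ξ : ℂ, ξ ≠ 0 → Filter.Tendsto (fun m : ℕ =>
      ‖c (m + 1 + 1) / ((m + 1).factorial : ℂ) * ξ^(m + 1)‖ /
        ‖c (m + 1) / (m.factorial : ℂ) * ξ^m‖) Filter.atTop (nhds (3/4 * ‖ξ‖)) := by
    intro ξ hξ
    have hL : Filter.Tendsto (fun m : ℕ => 3/4 * ‖ξ‖ *
        ((1 + (1/6) * (1 / ((m : ℝ) + 1))) * (1 - (1/6) * (1 / (((m + 1 : ℕ) : ℝ) + 1)))))
        Filter.atTop (nhds (3/4 * ‖ξ‖ * ((1 + (1/6) * 0) * (1 - (1/6) * 0)))) := by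
      have t := tendsto_one_div_add_atTop_nhds_zero_nat (𝕜 := ℝ)
      have t2 := t.comp (Filter.tendsto_add_atTop_nat 1)
      exact (((t.const_mul _).const_add _).mul ((t2.const_mul _).const_sub _)).const_mul _
    have hs : 3/4 * ‖ξ‖ * ((1 + (1/6) * 0) * (1 - (1/6) * 0)) = 3/4 * ‖ξ‖ := by ring
    rw [hs] at hL
    refine hL.congr fun m => ?_
    have hf : (m.factorial : ℂ) ≠ 0 := by exact_mod_cast m.factorial_ne_zero
    have hm1 := g1 m
    have hm2 := g1 (m + 1)
    rw [← norm_div]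
    have key : c (m + 1 + 1) / ((m + 1).factorial : ℂ) * ξ^(m + 1) /
        (c (m + 1) / (m.factorial : ℂ) * ξ^m) =
        ((-(3/4 * ((1 + (1/6) * (1 / ((m : ℝ) + 1))) *
          (1 - (1/6) * (1 / (((m + 1 : ℕ) : ℝ) + 1))))) : ℝ) : ℂ) * ξ := by
      have := hne m
      rw [hrec (m + 1) (by omega), Nat.factorial_succ]
      push_cast at hm2 ⊢
      field_simp
      ring
    rw [key, norm_mul, Complex.norm_real, norm_neg, Real.norm_of_nonneg]
    · ring
    · have : 1 / (((m + 1 : ℕ) : ℝ) + 1) ≤ 1 := by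
        rw [div_le_one (by positivity)]
        have : (0 : ℝ) ≤ ((m + 1 : ℕ) : ℝ) := by positivity
        linarith
      have h2 : (0 : ℝ) ≤ 1 - (1/6) * (1 / (((m + 1 : ℕ) : ℝ) + 1)) := by linarith
      positivity
  constructor
  · intro ξ hξ
    by_cases h0 : ξ = 0
    · subst h0
      refine summable_of_ne_finset_zero (s := {0}) fun m hm => ?_
      have : m ≠ 0 := by simpa using hm
      simp [this]
    · refine summable_of_ratio_test_tendsto_lt_one (by linarith) ?_ (hlim ξ h0)
      refine Filter.Eventually.of_forall fun m => ?_
      have hf : (m.factorial : ℂ) ≠ 0 := by exact_mod_cast m.factorial_ne_zero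
      exact mul_ne_zero (div_ne_zero (hne m) hf) (pow_ne_zero _ h0)
  · intro ξ hξ
    have h0 : ξ ≠ 0 := by
      rintro rfl
      simp at hξ
      linarith
    exact not_summable_of_ratio_test_tendsto_gt_one (by linarith) (hlim ξ h0)
end

section
/- Let U ⊆ ℂ \ {0} be open, let F : U → ℂ be holomorphic, and let r, ρ : U → ℂ be holomorphic functions with r(z)² = z and z · ρ(z)⁴ = 1 for all z ∈ U (branches of z^{1/2} and z^{-1/4}). Let N ≥ 1 and let g_0, …, g_N : U → ℂ be holomorphic with g_0 ≡ 1, satisfying for every 0 ≤ n ≤ N-1 and every z ∈ U the transport equation 32 r(z)⁵ g_{n+1}'(z) − 16 z² g_n''(z) + 8 z g_n'(z) + (16 z² F(z) − 5) g_n(z) = 0. Then for every ε ∈ ℂ \ {0} the function Φ_N(z) := e^{-(2/(3ε)) r(z)³} · ρ(z) · Σ_{n=0}^{N} g_n(z) ε^n satisfies, for all z ∈ U: Φ_N''(z) − (z/ε²) Φ_N(z) − F(z) Φ_N(z) = ε^N · e^{-(2/(3ε)) r(z)³} · ( (ρ·g_N)''(z) − F(z) ρ(z) g_N(z) ). -/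
open Complex Metric

lemma wkb_hr' {U : Set ℂ} (hU : IsOpen U) (hU0 : (0 : ℂ) ∉ U) {r : ℂ → ℂ}
    (hr : DifferentiableOn ℂ r U) (hr2 : ∀ z ∈ U, r z ^ 2 = z) {z : ℂ} (hz : z ∈ U) :
    HasDerivAt r (1 / (2 * r z)) z := by
  have hz0 : z ≠ 0 := fun h => hU0 (h ▸ hz)
  have hr0 : r z ≠ 0 := fun h => hz0 (by rw [← hr2 z hz, h]; simp)
  have h1 := (hr.differentiableAt (hU.mem_nhds hz)).hasDerivAt
  have h2 := h1.pow 2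
  have h3 : HasDerivAt (r ^ 2) 1 z := by
    refine (hasDerivAt_id z).congr_of_eventuallyEq ?_
    filter_upwards [hU.mem_nhds hz] with w hw
    simpa using hr2 w hw
  have h4 := h2.unique h3
  have h5 : deriv r z = 1 / (2 * r z) := by
    rw [eq_div_iff (by simpa using hr0)]
    linear_combination h4
  rwa [h5] at h1

lemma wkb_hrho {U : Set ℂ} (hU : IsOpen U) (hU0 : (0 : ℂ) ∉ U) {ρ : ℂ → ℂ}
    (hρ : DifferentiableOn ℂ ρ U) (hρ4 : ∀ z ∈ U, z * ρ z ^ 4 = 1) {z : ℂ} (hz : z ∈ U) :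
    HasDerivAt ρ (-ρ z / (4 * z)) z := by
  have hz0 : z ≠ 0 := fun h => hU0 (h ▸ hz)
  have hp0 : ρ z ≠ 0 := fun h => by have := hρ4 z hz; simp [h] at this
  have h1 := (hρ.differentiableAt (hU.mem_nhds hz)).hasDerivAt
  have h2 := (hasDerivAt_id z).mul (h1.pow 4)
  have h3 : HasDerivAt (id * ρ ^ 4) 0 z := by
    refine (hasDerivAt_const z (1 : ℂ)).congr_of_eventuallyEq ?_
    filter_upwards [hU.mem_nhds hz] with w hw
    simpa using hρ4 w hw
  have h4 := h2.unique h3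
  have h5 : deriv ρ z = -ρ z / (4 * z) := by
    rw [eq_div_iff (by simpa using hz0)]
    have h6 : ρ z ^ 3 * (deriv ρ z * (4 * z) + ρ z) = 0 := by
      simp at h4
      linear_combination h4
    have h7 := (mul_eq_zero.mp h6).resolve_left (pow_ne_zero 3 hp0)
    linear_combination h7
  rwa [h5] at h1

lemma wkb_second {U : Set ℂ} (hU : IsOpen U) (hU0 : (0 : ℂ) ∉ U) {r ρ h : ℂ → ℂ}
    (hr : DifferentiableOn ℂ r U) (hρ : DifferentiableOn ℂ ρ U)
    (hr2 : ∀ z ∈ U, r z ^ 2 = z) (hρ4 : ∀ z ∈ U, z * ρ z ^ 4 = 1)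
    (hh : DifferentiableOn ℂ h U) (c : ℂ) {z : ℂ} (hz : z ∈ U) :
    deriv (deriv (fun w => Complex.exp (-(2/3*c) * r w ^ 3) * ρ w * h w)) z =
      Complex.exp (-(2/3*c) * r z ^ 3) * ρ z *
        (deriv (deriv h) z - deriv h z / (2 * z) + 5 / (16 * z^2) * h z
          - 2 * c * r z * deriv h z + c^2 * z * h z) := by
  have hE : ∀ w ∈ U, HasDerivAt (fun w => Complex.exp (-(2/3*c) * r w ^ 3))
      (Complex.exp (-(2/3*c) * r w ^ 3) * (-c * r w)) w := by
    intro w hw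
    have hw0 : w ≠ 0 := fun h => hU0 (h ▸ hw)
    have hr0 : r w ≠ 0 := fun h => hw0 (by rw [← hr2 w hw, h]; simp)
    refine (((wkb_hr' hU hU0 hr hr2 hw).fun_pow 3).const_mul (-(2/3*c))).cexp.congr_deriv ?_
    congr 1
    norm_num
    field_simp
  have hEρ : ∀ w ∈ U, HasDerivAt (fun w => Complex.exp (-(2/3*c) * r w ^ 3) * ρ w)
      (Complex.exp (-(2/3*c) * r w ^ 3) * ρ w * (-c * r w - 1 / (4 * w))) w := by
    intro w hw
    refine ((hE w hw).fun_mul (wkb_hrho hU hU0 hρ hρ4 hw)).congr_deriv ?_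
    ring
  have hfirst : deriv (fun w => Complex.exp (-(2/3*c) * r w ^ 3) * ρ w * h w) =ᶠ[nhds z]
      fun w => Complex.exp (-(2/3*c) * r w ^ 3) * ρ w *
        ((-c * r w - 1 / 4 * w⁻¹) * h w + deriv h w) := by
    filter_upwards [hU.mem_nhds hz] with w hw
    rw [((hEρ w hw).fun_mul (hh.differentiableAt (hU.mem_nhds hw)).hasDerivAt).deriv]
    ring
  rw [hfirst.deriv_eq]
  have hz0 : z ≠ 0 := fun h => hU0 (h ▸ hz)
  have hr0 : r z ≠ 0 := fun h => hz0 (by rw [← hr2 z hz, h]; simp)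
  have hd := (hh.differentiableAt (hU.mem_nhds hz)).hasDerivAt
  have hdd := ((hh.deriv hU).differentiableAt (hU.mem_nhds hz)).hasDerivAt
  have hk := ((wkb_hr' hU hU0 hr hr2 hz).const_mul (-c)).sub
    ((hasDerivAt_inv hz0).const_mul (1/4))
  have key := (hEρ z hz).mul ((hk.mul hd).add hdd)
  refine key.deriv.trans ?_
  simp only [Pi.add_apply, Pi.mul_apply, Pi.sub_apply]
  rw [mul_assoc (_ * ρ z), ← mul_add]
  congr 1
  have hz2 := hr2 z hz
  generalize r z = R at *
  subst hz2
  field_simp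
  ring

/-- A truncation at order `N` of a formal WKB solution of
`Φ'' − (z/ε²)Φ = F(z)Φ`, whose coefficients satisfy the transport equations,
solves the equation up to the explicit remainder
`ε^N e^{-(2/(3ε)) r(z)³} ((ρ g_N)'' − F ρ g_N)`. -/
theorem wkb_truncation_remainder (U : Set ℂ) (hU : IsOpen U) (hU0 : (0 : ℂ) ∉ U)
    (F r ρ : ℂ → ℂ)
    (hF : DifferentiableOn ℂ F U) (hr : DifferentiableOn ℂ r U)
    (hρ : DifferentiableOn ℂ ρ U)
    (hr2 : ∀ z ∈ U, r z ^ 2 = z) (hρ4 : ∀ z ∈ U, z * ρ z ^ 4 = 1)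
    (N : ℕ) (hN : 1 ≤ N) (g : ℕ → ℂ → ℂ)
    (hg : ∀ n ≤ N, DifferentiableOn ℂ (g n) U)
    (hg0 : ∀ z ∈ U, g 0 z = 1)
    (htransport : ∀ n < N, ∀ z ∈ U,
      32 * r z ^ 5 * deriv (g (n + 1)) z - 16 * z^2 * deriv (deriv (g n)) z
        + 8 * z * deriv (g n) z + (16 * z^2 * F z - 5) * g n z = 0)
    (ε : ℂ) (hε : ε ≠ 0) :
    ∀ z ∈ U,
      deriv (deriv (fun w => Complex.exp (-(2/(3*ε)) * r w ^ 3) * ρ w *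
          ∑ n ∈ Finset.range (N + 1), g n w * ε^n)) z
        - (z/ε^2) * (Complex.exp (-(2/(3*ε)) * r z ^ 3) * ρ z *
            ∑ n ∈ Finset.range (N + 1), g n z * ε^n)
        - F z * (Complex.exp (-(2/(3*ε)) * r z ^ 3) * ρ z *
            ∑ n ∈ Finset.range (N + 1), g n z * ε^n)
      = ε^N * Complex.exp (-(2/(3*ε)) * r z ^ 3) *
          (deriv (deriv (fun w => ρ w * g N w)) z - F z * (ρ z * g N z)) := by
  intro z hz
  have hz0 : z ≠ 0 := fun h => hU0 (h ▸ hz)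
  have hr0 : r z ≠ 0 := fun h => hz0 (by rw [← hr2 z hz, h]; simp)
  have hG : DifferentiableOn ℂ (fun w => ∑ n ∈ Finset.range (N + 1), g n w * ε^n) U :=
    DifferentiableOn.fun_sum fun n hn =>
      (hg n (by simp at hn; omega)).mul_const _
  have hG1 : ∀ w ∈ U, deriv (fun w => ∑ n ∈ Finset.range (N + 1), g n w * ε^n) w =
      ∑ n ∈ Finset.range (N + 1), deriv (g n) w * ε^n := by
    intro w hw
    refine (HasDerivAt.fun_sum fun n hn => ?_).deriv
    exact (((hg n (by simp at hn; omega)).differentiableAt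
      (hU.mem_nhds hw)).hasDerivAt).mul_const _
  have hG2 : deriv (deriv (fun w => ∑ n ∈ Finset.range (N + 1), g n w * ε^n)) z =
      ∑ n ∈ Finset.range (N + 1), deriv (deriv (g n)) z * ε^n := by
    have : deriv (fun w => ∑ n ∈ Finset.range (N + 1), g n w * ε^n) =ᶠ[nhds z]
        fun w => ∑ n ∈ Finset.range (N + 1), deriv (g n) w * ε^n := by
      filter_upwards [hU.mem_nhds hz] with w hw using hG1 w hw
    rw [this.deriv_eq]
    refine (HasDerivAt.fun_sum fun n hn => ?_).deriv
    exact ((((hg n (by simp at hn; omega)).deriv hU).differentiableAt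
      (hU.mem_nhds hz)).hasDerivAt).mul_const _
  have hc : 2 / (3 * ε) = 2 / 3 * ε⁻¹ := by field_simp
  have e1 := wkb_second hU hU0 hr hρ hr2 hρ4 hG ε⁻¹ hz
  have e2 := wkb_second hU hU0 hr hρ hr2 hρ4 (hg N le_rfl) 0 hz
  simp only [mul_zero, neg_zero, zero_mul, Complex.exp_zero, one_mul] at e2
  rw [hc, e1, e2, hG2, hG1 z hz]
  have hg0' : deriv (g 0) z = 0 := by
    have : g 0 =ᶠ[nhds z] fun _ => 1 := by
      filter_upwards [hU.mem_nhds hz] with w hw using hg0 w hw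
    rw [this.deriv_eq]; simp
  have hsum : ∀ M ≤ N, ∑ n ∈ Finset.range (M + 1),
      (deriv (deriv (g n)) z - deriv (g n) z / (2 * z) + 5 / (16 * z^2) * g n z
        - F z * g n z - 2 * ε⁻¹ * r z * deriv (g n) z) * ε^n =
      ε^M * (deriv (deriv (g M)) z - deriv (g M) z / (2 * z) + 5 / (16 * z^2) * g M z
        - F z * g M z) := by
    intro M
    induction M with
    | zero => intro _; simp [hg0']
    | succ M ih =>
      intro hM
      rw [Finset.sum_range_succ, ih (by omega)]
      have ht := htransport M (by omega) z hz
      have hA : deriv (deriv (g M)) z - deriv (g M) z / (2 * z) + 5 / (16 * z^2) * g M z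
          - F z * g M z = 2 * r z * deriv (g (M + 1)) z := by
        have h5 : r z ^ 5 = z ^ 2 * r z := by
          have := hr2 z hz
          calc r z ^ 5 = (r z ^ 2) ^ 2 * r z := by ring
            _ = _ := by rw [this]
        rw [h5] at ht
        field_simp
        linear_combination -2 * ht
      rw [hA]
      field_simp
      ring
  have hs := hsum N le_rfl
  have hs' : ∑ n ∈ Finset.range (N + 1),
      (deriv (deriv (g n)) z - deriv (g n) z / (2 * z) + 5 / (16 * z^2) * g n z
        - F z * g n z - 2 * ε⁻¹ * r z * deriv (g n) z) * ε^n =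
      (∑ n ∈ Finset.range (N + 1), deriv (deriv (g n)) z * ε^n)
      - (1 / (2 * z) + 2 * ε⁻¹ * r z) * (∑ n ∈ Finset.range (N + 1), deriv (g n) z * ε^n)
      + (5 / (16 * z^2) - F z) * (∑ n ∈ Finset.range (N + 1), g n z * ε^n) := by
    rw [Finset.mul_sum, Finset.mul_sum, ← Finset.sum_sub_distrib, ← Finset.sum_add_distrib]
    refine Finset.sum_congr rfl fun n _ => ?_
    ring
  rw [hs'] at hs
  linear_combination (Complex.exp (-(2 / 3 * ε⁻¹) * r z ^ 3) * ρ z) * hs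
end

section
/- Let F be holomorphic on a disk D(0,ρ₀) ⊂ ℂ. Then there exist ρ₁ > 0 with ρ₁ ≤ ρ₀ and a sequence (h_n)_{n≥0} of holomorphic functions on D(0,ρ₁) with h_0 ≡ 1, such that on the slit disk D(0,ρ₁) \ (-∞,0], using the principal branches of the powers z^{s}, the functions g_n(z) := z^{-3n/2} h_n(z) satisfy, for every n ≥ 0, the transport equation 32 z^{5/2} g_{n+1}'(z) − 16 z² g_n''(z) + 8 z g_n'(z) + (16 z² F(z) − 5) g_n(z) = 0. -/
open Complex Metric

/-- Euler-type operator `z d/dz - 3n/2`. -/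
noncomputable def wkbD (n : ℕ) (f : ℂ → ℂ) : ℂ → ℂ :=
  fun z => z * deriv f z - 3 / 2 * (n : ℂ) * f z

/-- Right-hand side of the transport equation. -/
noncomputable def wkbT (F : ℂ → ℂ) (n : ℕ) (f : ℂ → ℂ) : ℂ → ℂ :=
  fun z => 1 / 2 * wkbD n (wkbD n f) z - 3 / 4 * wkbD n f z
    + (5 / 32 - 1 / 2 * z ^ 2 * F z) * f z

lemma wkbD_diff {ρ : ℝ} {f : ℂ → ℂ} (n : ℕ) (hf : DifferentiableOn ℂ f (ball 0 ρ)) :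
    DifferentiableOn ℂ (wkbD n f) (ball 0 ρ) := by
  unfold wkbD
  exact (differentiableOn_id.mul (hf.deriv isOpen_ball)).sub (hf.const_mul _)

lemma wkbT_diff {ρ : ℝ} {F f : ℂ → ℂ} (n : ℕ) (hF : DifferentiableOn ℂ F (ball 0 ρ))
    (hf : DifferentiableOn ℂ f (ball 0 ρ)) :
    DifferentiableOn ℂ (wkbT F n f) (ball 0 ρ) := by
  unfold wkbT
  have h1 := wkbD_diff n hf
  have h2 := wkbD_diff n h1
  fun_prop

/-- Nonresonant case. -/
lemma wkb_solve {ρ : ℝ} {G : ℂ → ℂ} (b : ℂ) (hG : DifferentiableOn ℂ G (ball 0 ρ))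
    (hb : ∀ k : ℕ, 1 / 2 ≤ ‖(k : ℂ) - b‖) :
    ∃ H : ℂ → ℂ, DifferentiableOn ℂ H (ball 0 ρ) ∧
      ∀ z ∈ ball (0 : ℂ) ρ, z * deriv H z - b * H z = G z := by
  set c : ℕ → ℂ := fun k => (k.factorial : ℂ)⁻¹ * iteratedDeriv k G 0 with hc
  have hs : ∀ z ∈ ball (0 : ℂ) ρ, HasSum (fun k => c k * z ^ k) (G z) := by
    intro z hz
    have := Complex.hasSum_taylorSeries_on_ball hG hz
    refine this.congr_fun ?_ |> id
    intro k
    simp [hc]; ring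
  set e : ℕ → ℂ → ℂ := fun k z => c k / ((k : ℂ) - b) * z ^ k with he
  have hne : ∀ k : ℕ, (k : ℂ) - b ≠ 0 := by
    intro k h
    have := hb k
    rw [h] at this
    norm_num at this
  have key : ∀ r : ℝ, 0 < r → r < ρ →
      DifferentiableOn ℂ (fun z => ∑' k, e k z) (ball 0 r) ∧
      ∀ z ∈ ball (0 : ℂ) r, HasSum (fun k => deriv (e k) z) (deriv (fun w => ∑' k, e k w) z) := by
    intro r hr hrρ
    have hu : Summable (fun k => 2 * ‖c k * (r : ℂ) ^ k‖) :=
      ((hs (r : ℂ) (by simpa [abs_of_pos hr] using hrρ)).summable.norm).mul_left 2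
    have hde : ∀ k, DifferentiableOn ℂ (e k) (ball 0 r) := by
      intro k; simp only [he]; fun_prop
    have hbd : ∀ (k : ℕ) (w : ℂ), w ∈ ball (0 : ℂ) r → ‖e k w‖ ≤ 2 * ‖c k * (r : ℂ) ^ k‖ := by
      intro k w hw
      have hw' : ‖w‖ ≤ r := by simpa using (mem_ball_zero_iff.1 hw).le
      simp only [he, norm_mul, norm_div, norm_pow, Complex.norm_real, Real.norm_eq_abs,
        abs_of_pos hr]
      have h1 : ‖c k‖ / ‖(k : ℂ) - b‖ ≤ 2 * ‖c k‖ := by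
        rw [div_le_iff₀ (by linarith [hb k])]
        nlinarith [hb k, norm_nonneg (c k)]
      calc _ ≤ (2 * ‖c k‖) * r ^ k := by gcongr
        _ = _ := by ring
    exact ⟨differentiableOn_tsum_of_summable_norm hu hde isOpen_ball hbd,
      fun z hz => hasSum_deriv_of_summable_norm hu hde isOpen_ball hbd hz⟩
  have mid : ∀ z ∈ ball (0 : ℂ) ρ, ∃ r, 0 < r ∧ r < ρ ∧ z ∈ ball (0 : ℂ) r := by
    intro z hz
    have hz' := mem_ball_zero_iff.1 hz
    have := norm_nonneg z
    exact ⟨(‖z‖ + ρ) / 2, by linarith, by linarith, mem_ball_zero_iff.2 (by linarith)⟩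
  refine ⟨fun z => ∑' k, e k z, ?_, ?_⟩
  · intro z hz
    obtain ⟨r, hr, hrρ, hzr⟩ := mid z hz
    exact ((key r hr hrρ).1.differentiableAt (isOpen_ball.mem_nhds hzr)).differentiableWithinAt
  · intro z hz
    obtain ⟨r, hr, hrρ, hzr⟩ := mid z hz
    have h1 := ((key r hr hrρ).2 z hzr).mul_left z
    have hd : ∀ k, z * deriv (e k) z = c k * z ^ k + b * e k z := by
      intro k
      have : deriv (e k) z = c k / ((k : ℂ) - b) * (k * z ^ (k - 1)) := by
        simp only [he]
        rw [deriv_const_mul _ (by fun_prop)]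
        simp
      rw [this]
      have hk : z * ((k : ℂ) * z ^ (k - 1)) = k * z ^ k := by
        cases k with
        | zero => simp
        | succ m => simp [pow_succ]; ring
      calc _ = c k / ((k : ℂ) - b) * (z * ((k : ℂ) * z ^ (k - 1))) := by ring
        _ = _ := by
          rw [hk]; simp only [he]
          have := hne k
          field_simp
          ring
    simp only [hd] at h1
    have h2 := h1.sub (hs z hz)
    simp only [add_sub_cancel_left] at h2
    by_cases hb0 : b = 0
    · exact absurd (by simp [hb0]) (hne 0)
    · have h3 := h2.mul_left b⁻¹
      simp only [inv_mul_cancel_left₀ hb0] at h3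
      have h4 := h3.tsum_eq
      simp only [h4]
      field_simp
      ring

/-- Algebraic identity behind the resonant case. -/
lemma wkb_alg (n : ℕ) (hn : Odd n) (u d e : ℕ → ℂ) (V : ℂ) (hu : u 0 = 1)
    (hd : ∀ k < n, d (k + 1) = 1 / 2 * e k - 3 / 4 * d k + V * u k) :
    -(1 / 2) * (∑ i ∈ Finset.range n, (-1) ^ (i + 1) *
        (d (i + 1) * u (n - i) + u (i + 1) * d (n - i))
      + ∑ k ∈ Finset.range (n + 1), (-1) ^ k *
        (d (n - k) * d k + u (n - k) * (e k - 3 / 2 * d k)))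
      = 1 / 2 * e n - 3 / 4 * d n + V * u n := by
  set t : ℕ → ℂ := fun k => 1 / 2 * e k - 3 / 4 * d k + V * u k with ht
  have anti : ∀ x : ℕ → ℂ, ∑ k ∈ Finset.range (n + 1), (-1) ^ k * (x (n - k) * x k) = 0 := by
    intro x
    have h := Finset.sum_range_reflect (fun k => (-1 : ℂ) ^ k * (x (n - k) * x k)) (n + 1)
    have h2 : ∑ j ∈ Finset.range (n + 1), (-1 : ℂ) ^ (n + 1 - 1 - j) *
        (x (n - (n + 1 - 1 - j)) * x (n + 1 - 1 - j))
        = - ∑ k ∈ Finset.range (n + 1), (-1 : ℂ) ^ k * (x (n - k) * x k) := by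
      rw [← Finset.sum_neg_distrib]
      refine Finset.sum_congr rfl fun j hj => ?_
      have hj' : j ≤ n := by simpa [Nat.lt_succ_iff] using hj
      have e1 : n + 1 - 1 - j = n - j := by omega
      have e2 : n - (n - j) = j := by omega
      have e3 : (-1 : ℂ) ^ (n - j) = - (-1) ^ j := by
        rcases Nat.even_or_odd j with hj2 | hj2
        · rw [hj2.neg_one_pow, (Nat.Odd.sub_even hj' hn hj2).neg_one_pow]
        · rw [hj2.neg_one_pow, (Nat.Odd.sub_odd hn hj2).neg_one_pow]; simp
      rw [e1, e2, e3]; ring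
    rw [h2] at h
    linear_combination (-1 / 2 : ℂ) * h
  have first : ∑ i ∈ Finset.range n, (-1 : ℂ) ^ (i + 1) * (u (i + 1) * d (n - i))
      = ∑ i ∈ Finset.range n, (-1 : ℂ) ^ (i + 1) * (d (i + 1) * u (n - i)) := by
    rw [← Finset.sum_range_reflect]
    refine Finset.sum_congr rfl fun j hj => ?_
    have hj' : j < n := by simpa using hj
    have e1 : n - 1 - j + 1 = n - j := by omega
    have e2 : n - (n - 1 - j) = j + 1 := by omega
    have e3 : (-1 : ℂ) ^ (n - j) = (-1) ^ (j + 1) := by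
      rcases Nat.even_or_odd j with hj2 | hj2
      · rw [hj2.add_one.neg_one_pow, (Nat.Odd.sub_even hj'.le hn hj2).neg_one_pow]
      · rw [hj2.add_one.neg_one_pow, (Nat.Odd.sub_odd hn hj2).neg_one_pow]
    rw [e1, e2, e3]; ring
  have A : ∑ i ∈ Finset.range n, (-1 : ℂ) ^ (i + 1) *
        (d (i + 1) * u (n - i) + u (i + 1) * d (n - i))
      = -2 * ∑ i ∈ Finset.range n, (-1 : ℂ) ^ i * (u (n - i) * t i) := by
    simp only [mul_add, Finset.sum_add_distrib]
    rw [first, ← two_mul, neg_mul, ← mul_neg, ← Finset.sum_neg_distrib]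
    congr 1
    refine Finset.sum_congr rfl fun j hj => ?_
    rw [hd j (by simpa using hj), pow_succ]
    simp only [ht]; ring
  have B : ∑ k ∈ Finset.range (n + 1), (-1 : ℂ) ^ k *
        (d (n - k) * d k + u (n - k) * (e k - 3 / 2 * d k))
      = 2 * ∑ k ∈ Finset.range (n + 1), (-1 : ℂ) ^ k * (u (n - k) * t k) := by
    have : ∀ k, (-1 : ℂ) ^ k * (d (n - k) * d k + u (n - k) * (e k - 3 / 2 * d k))
        = (-1 : ℂ) ^ k * (d (n - k) * d k) + 2 * ((-1 : ℂ) ^ k * (u (n - k) * t k))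
          - 2 * V * ((-1 : ℂ) ^ k * (u (n - k) * u k)) := by
      intro k; simp only [ht]; ring
    simp only [this]
    rw [Finset.sum_sub_distrib, Finset.sum_add_distrib, ← Finset.mul_sum, ← Finset.mul_sum,
      anti d, anti u]
    ring
  rw [A, B, Finset.sum_range_succ, hn.neg_one_pow]
  simp only [Nat.sub_self, hu, ht]
  ring

/-- Resonant case. -/
lemma wkb_even {ρ : ℝ} {F : ℂ → ℂ} (h : ℕ → ℂ → ℂ) (n : ℕ) (hn : Odd n)
    (h0 : ∀ z ∈ ball (0 : ℂ) ρ, h 0 z = 1)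
    (hdiff : ∀ k ≤ n, DifferentiableOn ℂ (h k) (ball 0 ρ))
    (heq : ∀ k < n, ∀ z ∈ ball (0 : ℂ) ρ, wkbD (k + 1) (h (k + 1)) z = wkbT F k (h k) z) :
    ∃ H : ℂ → ℂ, DifferentiableOn ℂ H (ball 0 ρ) ∧
      ∀ z ∈ ball (0 : ℂ) ρ, wkbD (n + 1) H z = wkbT F n (h n) z := by
  have hda : ∀ z ∈ ball (0 : ℂ) ρ, HasDerivAt (fun z =>
      -(1 / 2 : ℂ) * (∑ i ∈ Finset.range n, (-1) ^ (i + 1) * (h (i + 1) z * h (n - i) z)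
      + ∑ k ∈ Finset.range (n + 1), (-1) ^ k * (h (n - k) z * wkbD k (h k) z)))
      (-(1 / 2 : ℂ) * (∑ i ∈ Finset.range n, (-1) ^ (i + 1) *
        (deriv (h (i + 1)) z * h (n - i) z + h (i + 1) z * deriv (h (n - i)) z)
      + ∑ k ∈ Finset.range (n + 1), (-1) ^ k * (deriv (h (n - k)) z * wkbD k (h k) z
        + h (n - k) z * deriv (wkbD k (h k)) z))) z := by
    intro z hz
    have hat : ∀ k ≤ n, HasDerivAt (h k) (deriv (h k) z) z := fun k hk =>
      ((hdiff k hk).differentiableAt (isOpen_ball.mem_nhds hz)).hasDerivAt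
    have hat2 : ∀ k ≤ n, HasDerivAt (wkbD k (h k)) (deriv (wkbD k (h k)) z) z := fun k hk =>
      ((wkbD_diff k (hdiff k hk)).differentiableAt (isOpen_ball.mem_nhds hz)).hasDerivAt
    refine HasDerivAt.const_mul _ (HasDerivAt.add ?_ ?_)
    · refine HasDerivAt.fun_sum fun i hi => ?_
      have hi' : i < n := by simpa using hi
      exact ((hat (i + 1) (by omega)).mul (hat (n - i) (by omega))).const_mul _
    · refine HasDerivAt.fun_sum fun i hi => ?_
      have hi' : i < n + 1 := by simpa using hi
      exact ((hat (n - i) (by omega)).mul (hat2 i (by omega))).const_mul _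
  refine ⟨_, fun z hz => (hda z hz).differentiableAt.differentiableWithinAt, ?_⟩
  intro z hz
  have := wkb_alg n hn (fun k => h k z) (fun k => wkbD k (h k) z)
    (fun k => wkbD k (wkbD k (h k)) z) (5 / 32 - 1 / 2 * z ^ 2 * F z) (h0 z hz)
    (fun k hk => heq k hk z hz)
  unfold wkbT
  rw [← this]
  have q0 : ∀ (m : ℕ) (f : ℂ → ℂ), wkbD m f z = z * deriv f z - 3 / 2 * (m : ℂ) * f z :=
    fun m f => rfl
  rw [q0 (n + 1), (hda z hz).deriv]
  have P : ∀ (a s1 s2 s3 s4 s5 s6 : ℂ), z * s1 - a * s3 = s5 → z * s2 - a * s4 = s6 →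
      z * (-(1 / 2) * (s1 + s2)) - a * (-(1 / 2) * (s3 + s4)) = -(1 / 2) * (s5 + s6) := by
    intro a s1 s2 s3 s4 s5 s6 h1 h2
    rw [← h1, ← h2]; ring
  refine P _ _ _ _ _ _ _ ?_ ?_
  · rw [Finset.mul_sum, Finset.mul_sum, ← Finset.sum_sub_distrib]
    refine Finset.sum_congr rfl fun i hi => ?_
    have hi' : i ≤ n := by simpa using (Finset.mem_range.1 hi).le
    simp only [wkbD]
    push_cast [Nat.cast_sub hi']
    ring
  · rw [Finset.mul_sum, Finset.mul_sum, ← Finset.sum_sub_distrib]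
    refine Finset.sum_congr rfl fun i hi => ?_
    have hi' : i ≤ n := Nat.lt_succ_iff.1 (Finset.mem_range.1 hi)
    have q : ∀ m, wkbD m (wkbD m (h m)) z
        = z * deriv (wkbD m (h m)) z - 3 / 2 * (m : ℂ) * wkbD m (h m) z := fun m => rfl
    have q2 : wkbD (n - i) (h (n - i)) z
        = z * deriv (h (n - i)) z - 3 / 2 * ((n : ℂ) - i) * h (n - i) z := by
      simp only [wkbD]; push_cast [Nat.cast_sub hi']; ring
    rw [q, q2]
    simp only [wkbD]
    push_cast
    ring

lemma wkb_exists {ρ : ℝ} {F : ℂ → ℂ} (hF : DifferentiableOn ℂ F (ball 0 ρ)) :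
    ∃ h : ℕ → ℂ → ℂ, (∀ n, DifferentiableOn ℂ (h n) (ball 0 ρ)) ∧ (h 0 = fun _ => 1) ∧
      ∀ n, ∀ z ∈ ball (0 : ℂ) ρ, wkbD (n + 1) (h (n + 1)) z = wkbT F n (h n) z := by
  classical
  let P : ℕ → (ℂ → ℂ) → (ℂ → ℂ) → Prop := fun n f H =>
    DifferentiableOn ℂ H (ball 0 ρ) ∧ ∀ z ∈ ball (0 : ℂ) ρ, wkbD (n + 1) H z = wkbT F n f z
  let h : ℕ → ℂ → ℂ := fun n => Nat.rec (fun _ => 1) (fun n f => Classical.epsilon (P n f)) n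
  have hsucc : ∀ n, h (n + 1) = Classical.epsilon (P n (h n)) := fun n => rfl
  have h0 : h 0 = fun _ => 1 := rfl
  have main : ∀ n, P n (h n) (h (n + 1)) := by
    intro n
    induction n using Nat.strong_induction_on with
    | _ n ih =>
      have hdiff : ∀ k ≤ n, DifferentiableOn ℂ (h k) (ball 0 ρ) := by
        intro k hk
        cases k with
        | zero => rw [h0]; exact differentiableOn_const _
        | succ m => exact (ih m (by omega)).1
      rw [hsucc]
      apply Classical.epsilon_spec (p := P n (h n))
      rcases Nat.even_or_odd n with hn | hn
      · obtain ⟨H, hH1, hH2⟩ := wkb_solve (3 / 2 * ((n + 1 : ℕ) : ℂ))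
          (wkbT_diff n hF (hdiff n le_rfl)) (by
            intro k
            obtain ⟨m, rfl⟩ := hn
            have : (k : ℂ) - 3 / 2 * ((m + m + 1 : ℕ) : ℂ)
                = ((((2 * k - 3 * (2 * m + 1) : ℤ) : ℝ) / 2 : ℝ) : ℂ) := by
              push_cast; ring
            rw [this, Complex.norm_real, Real.norm_eq_abs, abs_div, abs_two]
            have h1 : (1 : ℤ) ≤ |2 * (k : ℤ) - 3 * (2 * (m : ℤ) + 1)| := Int.one_le_abs (by omega)
            have h2 : (1 : ℝ) ≤ |((2 * k - 3 * (2 * m + 1) : ℤ) : ℝ)| := by exact_mod_cast h1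
            linarith)
        exact ⟨H, hH1, hH2⟩
      · exact wkb_even h n hn (fun z _ => by rw [h0]) hdiff (fun k hk => (ih k hk).2)
  refine ⟨h, ?_, h0, fun n => (main n).2⟩
  intro n
  cases n with
  | zero => rw [h0]; exact differentiableOn_const _
  | succ m => exact (main m).1

lemma wkb_deriv {a z : ℂ} {f : ℂ → ℂ} (hz : z ∈ slitPlane) (hf : DifferentiableAt ℂ f z) :
    deriv (fun w => w ^ a * f w) z = z ^ (a - 1) * (z * deriv f z + a * f z) := by
  have hz0 : z ≠ 0 := slitPlane_ne_zero hz
  have h1 : HasDerivAt (fun w : ℂ => w ^ a) (a * z ^ (a - 1)) z := by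
    simpa using (hasDerivAt_id z).cpow_const (c := a) hz
  rw [(h1.fun_mul hf.hasDerivAt).deriv]
  have : z ^ a = z ^ (a - 1) * z := by
    rw [cpow_sub _ _ hz0, cpow_one]; field_simp
  rw [this]; ring

/-- For `F` holomorphic on a disk around `0` there exist holomorphic functions
`h_n` with `h_0 ≡ 1` such that, on the slit disk and with principal branches,
`g_n(z) = z^{-3n/2} h_n(z)` satisfy the WKB transport equations. -/
theorem elementary_wkb_transport_solutions (ρ₀ : ℝ) (hρ₀ : 0 < ρ₀) (F : ℂ → ℂ)
    (hF : DifferentiableOn ℂ F (Metric.ball 0 ρ₀)) :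
    ∃ ρ₁ : ℝ, 0 < ρ₁ ∧ ρ₁ ≤ ρ₀ ∧ ∃ h : ℕ → ℂ → ℂ,
      (∀ n, DifferentiableOn ℂ (h n) (Metric.ball 0 ρ₁)) ∧
      (∀ z ∈ Metric.ball (0 : ℂ) ρ₁, h 0 z = 1) ∧
      (∀ n : ℕ, ∀ z ∈ Metric.ball (0 : ℂ) ρ₁ \ {w : ℂ | w.im = 0 ∧ w.re ≤ 0},
        32 * z ^ ((5 : ℂ)/2) *
            deriv (fun w => w ^ (-(3 * ((n : ℂ) + 1))/2) * h (n + 1) w) z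
          - 16 * z^2 * deriv (deriv (fun w => w ^ (-(3 * (n : ℂ))/2) * h n w)) z
          + 8 * z * deriv (fun w => w ^ (-(3 * (n : ℂ))/2) * h n w) z
          + (16 * z^2 * F z - 5) * (z ^ (-(3 * (n : ℂ))/2) * h n z) = 0) := by
  obtain ⟨h, hd, h0, heq⟩ := wkb_exists hF
  refine ⟨ρ₀, hρ₀, le_rfl, h, hd, fun z _ => by rw [h0], ?_⟩
  rintro n z ⟨hz, hzs⟩
  have slit : ∀ w : ℂ, w ∈ slitPlane ↔ ¬ (w.im = 0 ∧ w.re ≤ 0) := by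
    intro w
    rw [mem_slitPlane_iff, not_and_or, not_le, or_comm]
  have hz1 : z ∈ slitPlane := (slit z).2 hzs
  have hz0 : z ≠ 0 := slitPlane_ne_zero hz1
  have dat : ∀ (f : ℂ → ℂ), DifferentiableOn ℂ f (ball 0 ρ₀) → ∀ w ∈ ball (0 : ℂ) ρ₀,
      DifferentiableAt ℂ f w := fun f hf w hw => hf.differentiableAt (isOpen_ball.mem_nhds hw)
  have D1 : ∀ m : ℕ, ∀ w ∈ ball (0 : ℂ) ρ₀ ∩ slitPlane,
      deriv (fun w => w ^ (-(3 * (m : ℂ))/2) * h m w) w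
        = w ^ (-(3 * (m : ℂ))/2 - 1) * wkbD m (h m) w := by
    intro m w hw
    rw [wkb_deriv hw.2 (dat _ (hd m) w hw.1)]
    simp only [wkbD]; ring
  have D2 : deriv (deriv (fun w => w ^ (-(3 * (n : ℂ))/2) * h n w)) z
      = z ^ (-(3 * (n : ℂ))/2 - 1 - 1) * (wkbD n (wkbD n (h n)) z - wkbD n (h n) z) := by
    have : deriv (fun w => w ^ (-(3 * (n : ℂ))/2) * h n w) =ᶠ[nhds z]
        fun w => w ^ (-(3 * (n : ℂ))/2 - 1) * wkbD n (h n) w :=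
      Filter.eventuallyEq_of_mem
        ((isOpen_ball.inter isOpen_slitPlane).mem_nhds ⟨hz, hz1⟩) (D1 n)
    rw [this.deriv_eq, wkb_deriv hz1 (dat _ (wkbD_diff n (hd n)) z hz)]
    have q : wkbD n (wkbD n (h n)) z
        = z * deriv (wkbD n (h n)) z - 3 / 2 * (n : ℂ) * wkbD n (h n) z := rfl
    rw [q]; ring
  have D3 := D1 (n + 1) z ⟨hz, hz1⟩
  push_cast at D3
  rw [D2, D3, D1 n z ⟨hz, hz1⟩, heq n z hz]
  have p1 : z ^ ((5 : ℂ)/2) * z ^ (-(3 * ((n : ℂ) + 1))/2 - 1) = z ^ (-(3 * (n : ℂ))/2) := by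
    rw [← cpow_add _ _ hz0]; congr 1; ring
  have p2 : z ^ (-(3 * (n : ℂ))/2) = z ^ (-(3 * (n : ℂ))/2 - 1) * z := by
    rw [cpow_sub _ _ hz0, cpow_one]; field_simp
  have p3 : z ^ (-(3 * (n : ℂ))/2 - 1) = z ^ (-(3 * (n : ℂ))/2 - 1 - 1) * z := by
    rw [cpow_sub (-(3 * (n : ℂ))/2 - 1) 1 hz0, cpow_one]; field_simp
  have p4 : 32 * z ^ ((5 : ℂ)/2) * (z ^ (-(3 * ((n : ℂ) + 1))/2 - 1) * wkbT F n (h n) z)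
      = 32 * z ^ (-(3 * (n : ℂ))/2) * wkbT F n (h n) z := by
    rw [← p1]; ring
  rw [p4, p2, p3]
  simp only [wkbT]
  ring
end

section
/- Let F be holomorphic on a disk D(0,ρ₀) ⊂ ℂ, and on the slit disk D(0,ρ₀) \ (-∞,0] let p_0(z) = z^{1/2} (principal branch). Define recursively p_1 = p_0'/(2p_0), p_2 = (p_1' − p_1² + F)/(2p_0), and p_{n+1} = (p_n' − Σ_{j=1}^{n} p_j p_{n+1-j})/(2p_0) for n ≥ 2. Then p_1(z) = 1/(4z), and for every n ≥ 2 there exist ρ_n > 0 and a holomorphic function q_n on D(0,ρ_n) such that p_n(z) = z^{-(3n-1)/2} q_n(z) on D(0,ρ_n) \ (-∞,0] (principal branch of z^{-(3n-1)/2}). -/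
open Complex Metric

/-- The coefficients `p_n` of the formal Riccati solution, defined recursively from
the principal branch `p_0(z) = z^{1/2}` on the slit disk, satisfy `p_1(z) = 1/(4z)`
and, for `n ≥ 2`, `p_n ∈ z^{-(3n-1)/2} ℂ{z}`. -/
theorem riccati_coefficients_singularity_order (ρ₀ : ℝ) (hρ₀ : 0 < ρ₀) (F : ℂ → ℂ)
    (hF : DifferentiableOn ℂ F (Metric.ball 0 ρ₀))
    (p : ℕ → ℂ → ℂ)
    (hp0 : ∀ z ∈ Metric.ball (0 : ℂ) ρ₀ \ {w : ℂ | w.im = 0 ∧ w.re ≤ 0},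
      p 0 z = z ^ ((1 : ℂ)/2))
    (hp1 : ∀ z ∈ Metric.ball (0 : ℂ) ρ₀ \ {w : ℂ | w.im = 0 ∧ w.re ≤ 0},
      p 1 z = deriv (p 0) z / (2 * p 0 z))
    (hp2 : ∀ z ∈ Metric.ball (0 : ℂ) ρ₀ \ {w : ℂ | w.im = 0 ∧ w.re ≤ 0},
      p 2 z = (deriv (p 1) z - (p 1 z)^2 + F z) / (2 * p 0 z))
    (hpn : ∀ n : ℕ, 2 ≤ n → ∀ z ∈ Metric.ball (0 : ℂ) ρ₀ \ {w : ℂ | w.im = 0 ∧ w.re ≤ 0},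
      p (n + 1) z =
        (deriv (p n) z - ∑ j ∈ Finset.Icc 1 n, p j z * p (n + 1 - j) z) / (2 * p 0 z)) :
    (∀ z ∈ Metric.ball (0 : ℂ) ρ₀ \ {w : ℂ | w.im = 0 ∧ w.re ≤ 0}, p 1 z = 1/(4*z)) ∧
    (∀ n : ℕ, 2 ≤ n → ∃ ρn : ℝ, 0 < ρn ∧ ρn ≤ ρ₀ ∧ ∃ q : ℂ → ℂ,
      DifferentiableOn ℂ q (Metric.ball 0 ρn) ∧
      ∀ z ∈ Metric.ball (0 : ℂ) ρn \ {w : ℂ | w.im = 0 ∧ w.re ≤ 0},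
        p n z = z ^ (-(3 * (n : ℂ) - 1)/2) * q z) := by
  set S : Set ℂ := Metric.ball (0 : ℂ) ρ₀ \ {w : ℂ | w.im = 0 ∧ w.re ≤ 0} with hS
  have hslit : ∀ z ∈ S, z ∈ slitPlane := by
    intro z hz
    have h2 : ¬ (z.im = 0 ∧ z.re ≤ 0) := hz.2
    rw [mem_slitPlane_iff]
    by_contra hcon
    push Not at hcon
    exact h2 ⟨hcon.2, hcon.1⟩
  have hS' : S = Metric.ball (0 : ℂ) ρ₀ ∩ slitPlane := by
    ext z
    refine ⟨fun hz => ⟨hz.1, hslit z hz⟩, fun hz => ⟨hz.1, ?_⟩⟩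
    rintro ⟨h1, h2⟩
    rcases mem_slitPlane_iff.1 hz.2 with h | h
    · linarith
    · exact h h1
  have hSo : IsOpen S := by
    rw [hS']
    exact Metric.isOpen_ball.inter isOpen_slitPlane
  have hne : ∀ z ∈ S, z ≠ 0 := fun z hz => slitPlane_ne_zero (hslit z hz)
  have hder : ∀ (f g : ℂ → ℂ), (∀ z ∈ S, f z = g z) → ∀ z ∈ S, deriv f z = deriv g z := by
    intro f g h z hz
    apply Filter.EventuallyEq.deriv_eq
    filter_upwards [hSo.mem_nhds hz] with w hw using h w hw
  have hcpow : ∀ (c : ℂ), ∀ z ∈ S, HasDerivAt (fun w : ℂ => w ^ c) (c * z ^ (c - 1)) z := by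
    intro c z hz
    simpa using (hasDerivAt_id z).cpow_const (c := c) (hslit z hz)
  have h1 : ∀ z ∈ S, p 1 z = 1 / (4 * z) := by
    intro z hz
    have hz0 := hne z hz
    rw [hp1 z hz, hder _ _ hp0 z hz, hp0 z hz, (hcpow _ z hz).deriv, cpow_sub _ _ hz0, cpow_one]
    have : z ^ ((1 : ℂ) / 2) ≠ 0 := by simp [cpow_eq_zero_iff, hz0]
    field_simp
    norm_num
  refine ⟨h1, ?_⟩
  have hrec : ∀ n : ℕ, 1 ≤ n → ∀ z ∈ S, p (n + 1) z =
      (deriv (p n) z - ∑ j ∈ Finset.Icc 1 n, p j z * p (n + 1 - j) z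
        + (if n = 1 then F z else 0)) / (2 * p 0 z) := by
    intro n hn z hz
    by_cases h : n = 1
    · subst h
      simp [hp2 z hz, sq]
    · rw [hpn n (by omega) z hz]
      simp [h]
  have key : ∀ n : ℕ, 1 ≤ n → ∃ q : ℂ → ℂ, DifferentiableOn ℂ q (Metric.ball 0 ρ₀) ∧
      ∀ z ∈ S, p n z = z ^ (-(3 * (n : ℂ) - 1)/2) * q z := by
    intro n
    induction n using Nat.strong_induction_on with
    | _ m ih =>
    intro hm
    obtain rfl | ⟨n, hn, rfl⟩ : m = 1 ∨ ∃ n, 1 ≤ n ∧ m = n + 1 := by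
      rcases Nat.lt_or_ge 1 m with h | h
      · exact Or.inr ⟨m - 1, by omega, by omega⟩
      · left; omega
    · refine ⟨fun _ => 1 / 4, differentiableOn_const _, ?_⟩
      intro z hz
      have hz0 := hne z hz
      rw [h1 z hz, show (-(3 * ((1 : ℕ) : ℂ) - 1)/2) = -1 by norm_num, cpow_neg_one]
      field_simp
    · have ih' : ∀ j : ℕ, ∃ q : ℂ → ℂ, j ∈ Finset.Icc 1 n →
          DifferentiableOn ℂ q (Metric.ball 0 ρ₀) ∧
          ∀ z ∈ S, p j z = z ^ (-(3 * (j : ℂ) - 1)/2) * q z := by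
        intro j
        by_cases hj : j ∈ Finset.Icc 1 n
        · rw [Finset.mem_Icc] at hj
          obtain ⟨q, hq⟩ := ih j (by omega) hj.1
          exact ⟨q, fun _ => hq⟩
        · exact ⟨0, fun h => absurd h hj⟩
      choose q hq using ih'
      have hnn : n ∈ Finset.Icc 1 n := by simp [hn]
      have hG : DifferentiableOn ℂ (fun z => if n = 1 then F z else 0) (Metric.ball 0 ρ₀) := by
        by_cases h : n = 1
        · simpa [h] using hF
        · simp [h]
      refine ⟨fun z => ((-(3 * (n : ℂ) - 1)/2) * q n z + z * deriv (q n) z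
        - ∑ j ∈ Finset.Icc 1 n, q j z * q (n + 1 - j) z
        + z ^ 2 * (if n = 1 then F z else 0)) / 2, ?_, ?_⟩
      · have hd : DifferentiableOn ℂ (deriv (q n)) (Metric.ball 0 ρ₀) :=
          (hq n hnn).1.deriv Metric.isOpen_ball
        have hs : DifferentiableOn ℂ
            (fun z => ∑ j ∈ Finset.Icc 1 n, q j z * q (n + 1 - j) z) (Metric.ball 0 ρ₀) := by
          apply DifferentiableOn.fun_sum
          intro j hj
          refine (hq j hj).1.mul (hq (n + 1 - j) ?_).1
          rw [Finset.mem_Icc] at hj ⊢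
          omega
        exact (((((hq n hnn).1.const_mul _).add (differentiableOn_id.mul hd)).sub hs).add
          ((differentiableOn_id.pow 2).mul hG)).div_const 2
      · intro z hz
        have hz0 := hne z hz
        have hqd : HasDerivAt (q n) (deriv (q n) z) z :=
          ((hq n hnn).1.differentiableAt (Metric.isOpen_ball.mem_nhds hz.1)).hasDerivAt
        have hsum : ∑ j ∈ Finset.Icc 1 n, p j z * p (n + 1 - j) z =
            z ^ (-(3 * (n : ℂ) + 1)/2) * ∑ j ∈ Finset.Icc 1 n, q j z * q (n + 1 - j) z := by
          rw [Finset.mul_sum]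
          apply Finset.sum_congr rfl
          intro j hj
          have hj' : n + 1 - j ∈ Finset.Icc 1 n := by
            rw [Finset.mem_Icc] at hj ⊢
            omega
          have hle : j ≤ n + 1 := by
            rw [Finset.mem_Icc] at hj
            omega
          rw [(hq j hj).2 z hz, (hq _ hj').2 z hz]
          have : (-(3 * (n : ℂ) + 1)/2) = (-(3 * (j : ℂ) - 1)/2)
              + (-(3 * ((n + 1 - j : ℕ) : ℂ) - 1)/2) := by
            rw [Nat.cast_sub hle]
            push_cast
            ring
          rw [this, cpow_add _ _ hz0]
          ring
        rw [hrec n hn z hz, hsum, hder _ _ (hq n hnn).2 z hz,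
          ((hcpow _ z hz).fun_mul hqd).deriv, hp0 z hz]
        have hF2 : (if n = 1 then F z else 0) =
            z ^ (-(3 * (n : ℂ) + 1)/2) * (z ^ 2 * (if n = 1 then F z else 0)) := by
          by_cases h : n = 1
          · subst h
            have : (-(3 * ((1 : ℕ) : ℂ) + 1)/2) = -((2 : ℕ) : ℂ) := by norm_num
            rw [this, cpow_neg, cpow_natCast]
            field_simp
          · simp [h]
        have e1 : z ^ (-(3 * (n : ℂ) - 1)/2 - 1) = z ^ (-(3 * (n : ℂ) + 1)/2) := by
          congr 1
          ring
        have e2 : z ^ (-(3 * (n : ℂ) - 1)/2) = z ^ (-(3 * (n : ℂ) + 1)/2) * z := by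
          rw [show (-(3 * (n : ℂ) - 1)/2) = (-(3 * (n : ℂ) + 1)/2) + 1 by ring,
            cpow_add _ _ hz0, cpow_one]
        have e3 : z ^ (-(3 * (n : ℂ) + 1)/2) =
            z ^ (-(3 * ((n + 1 : ℕ) : ℂ) - 1)/2) * z ^ ((1 : ℂ)/2) := by
          rw [← cpow_add _ _ hz0]
          congr 1
          push_cast
          ring
        beta_reduce
        generalize (if n = 1 then F z else 0) = G at hF2 ⊢
        nth_rewrite 1 [hF2]
        rw [e1, e2, e3]
        have hne2 : z ^ ((1 : ℂ) / 2) ≠ 0 := by simp [cpow_eq_zero_iff, hz0]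
        generalize z ^ ((1 : ℂ) / 2) = r at hne2 ⊢
        generalize z ^ (-(3 * ((n + 1 : ℕ) : ℂ) - 1)/2) = t
        field_simp
  intro n hn
  obtain ⟨q, h⟩ := key n (by omega)
  exact ⟨ρ₀, hρ₀, le_rfl, q, h⟩
end

section
/- Let r > 0 and let F, h be holomorphic on the disk D(0,r) ⊂ ℂ. Then there exists a unique sequence (a_n)_{n≥0} of holomorphic functions on D(0,r) such that a_0 ≡ 1, a_1 = h, and for every n ≥ 2 and z ∈ D(0,r): 4z·a_n'(z) + n·a_n(z) = (1/(n-1))·( −a_{n-2}''(z) + 2(n-2)·a_{n-1}'(z) + F(z)·a_{n-2}(z) ). Moreover, for every n ≥ 2 and z ∈ D(0,r): a_n(z) = (1/(n-1)) · ∫₀¹ u^{n-1} · ( −a_{n-2}''(u⁴z) + 2(n-2)·a_{n-1}'(u⁴z) + F(u⁴z)·a_{n-2}(u⁴z) ) du. -/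
open Complex Metric intervalIntegral

lemma scale_mem_ball {r : ℝ} {z : ℂ} (hz : z ∈ ball (0:ℂ) r) {u : ℝ} (hu : u ∈ Set.Icc (0:ℝ) 1) :
    (u:ℂ)^4 * z ∈ ball (0:ℂ) r := by
  rw [mem_ball_zero_iff] at *
  rw [norm_mul, norm_pow, Complex.norm_real, Real.norm_eq_abs, abs_of_nonneg hu.1]
  have : u^4 ≤ 1 := pow_le_one₀ hu.1 hu.2
  nlinarith [norm_nonneg z]

lemma scale_continuousOn {r : ℝ} {g : ℂ → ℂ} (hg : ContinuousOn g (ball 0 r)) (m : ℕ)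
    {z : ℂ} (hz : z ∈ ball (0:ℂ) r) :
    ContinuousOn (fun u : ℝ => (u:ℂ)^m * g ((u:ℂ)^4 * z)) (Set.uIcc 0 1) := by
  rw [Set.uIcc_of_le zero_le_one]
  refine ContinuousOn.mul (by fun_prop) ?_
  exact hg.comp (f := fun u : ℝ => (u:ℂ)^4 * z) (by fun_prop) (fun u hu => scale_mem_ball hz hu)

lemma scale_ftc {r : ℝ} {f : ℂ → ℂ} (hf : DifferentiableOn ℂ f (ball 0 r)) (m : ℕ)
    {z : ℂ} (hz : z ∈ ball (0:ℂ) r) :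
    ∫ u in (0:ℝ)..1, (u:ℂ)^(m+1) * (4 * ((u:ℂ)^4 * z) * deriv f ((u:ℂ)^4 * z)
      + ((m:ℂ)+2) * f ((u:ℂ)^4 * z)) = f z := by
  have hd := hf.deriv isOpen_ball
  have key := integral_eq_sub_of_hasDerivAt (a := 0) (b := 1)
    (f := fun u : ℝ => (u:ℂ)^(m+2) * f ((u:ℂ)^4 * z))
    (f' := fun u : ℝ => (u:ℂ)^(m+1) * (4 * ((u:ℂ)^4 * z) * deriv f ((u:ℂ)^4 * z)
      + ((m:ℂ)+2) * f ((u:ℂ)^4 * z))) ?_ ?_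
  · rw [key]; simp
  · intro u hu
    rw [Set.uIcc_of_le zero_le_one] at hu
    have hw := scale_mem_ball hz hu
    have h1 : HasDerivAt f (deriv f ((u:ℂ)^4 * z)) ((u:ℂ)^4 * z) :=
      (hf.differentiableAt (isOpen_ball.mem_nhds hw)).hasDerivAt
    have h2 : HasDerivAt (fun v : ℂ => v^4 * z) (4 * (u:ℂ)^3 * z) (u:ℂ) := by
      simpa using (hasDerivAt_pow 4 (u:ℂ)).mul_const z
    have h3 := HasDerivAt.comp (u:ℂ) (h₂ := f) (h := fun v : ℂ => v^4 * z) h1 h2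
    have h4 := ((hasDerivAt_pow (m+2) (u:ℂ)).mul h3).comp_ofReal
    refine HasDerivAt.congr_deriv h4 ?_
    simp only [Function.comp]
    push_cast
    ring
  · apply ContinuousOn.intervalIntegrable
    exact scale_continuousOn (g := fun w => 4 * w * deriv f w + ((m:ℂ)+2) * f w)
      (((by fun_prop : ContinuousOn (fun w : ℂ => 4 * w) _).mul hd.continuousOn).add
        (continuousOn_const.mul hf.continuousOn)) (m+1) hz

lemma scale_hasDerivAt {r : ℝ} {g : ℂ → ℂ} (hg : DifferentiableOn ℂ g (ball 0 r)) (m : ℕ)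
    {z : ℂ} (hz : z ∈ ball (0:ℂ) r) :
    HasDerivAt (fun z : ℂ => ∫ u in (0:ℝ)..1, (u:ℂ)^(m+1) * g ((u:ℂ)^4 * z))
      (∫ u in (0:ℝ)..1, (u:ℂ)^(m+5) * deriv g ((u:ℂ)^4 * z)) z := by
  have hd := hg.deriv isOpen_ball
  obtain ⟨R, hR1, hR2⟩ := exists_between (mem_ball_zero_iff.1 hz)
  have hsub : closedBall (0:ℂ) R ⊆ ball 0 r := closedBall_subset_ball hR2
  have hsub' : ball (0:ℂ) R ⊆ ball 0 r := ball_subset_ball hR2.le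
  obtain ⟨C, hC⟩ := (isCompact_closedBall (0:ℂ) R).exists_bound_of_continuousOn
    (hd.continuousOn.mono hsub)
  have hzR : ball (0:ℂ) R ∈ nhds z := isOpen_ball.mem_nhds (mem_ball_zero_iff.2 hR1)
  refine (intervalIntegral.hasDerivAt_integral_of_dominated_loc_of_deriv_le
    (F := fun (z : ℂ) (u : ℝ) => (u:ℂ)^(m+1) * g ((u:ℂ)^4 * z))
    (F' := fun (z : ℂ) (u : ℝ) => (u:ℂ)^(m+5) * deriv g ((u:ℂ)^4 * z))
    (bound := fun _ => C) hzR ?_ ?_ ?_ ?_ ?_ ?_).2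
  · filter_upwards [hzR] with x hx
    exact (scale_continuousOn hg.continuousOn (m+1) (hsub' hx)).intervalIntegrable.def'.aestronglyMeasurable
  · exact (scale_continuousOn hg.continuousOn (m+1) hz).intervalIntegrable
  · exact (scale_continuousOn hd.continuousOn (m+5) hz).intervalIntegrable.def'.aestronglyMeasurable
  · refine Filter.Eventually.of_forall fun u hu x hx => ?_
    rw [Set.uIoc_of_le zero_le_one] at hu
    have hu' : u ∈ Set.Icc (0:ℝ) 1 := ⟨hu.1.le, hu.2⟩
    have h1 := hC _ (ball_subset_closedBall (scale_mem_ball hx hu'))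
    rw [norm_mul, norm_pow, Complex.norm_real, Real.norm_eq_abs, abs_of_nonneg hu'.1]
    have : u^(m+5) ≤ 1 := pow_le_one₀ hu'.1 hu'.2
    have h0 := norm_nonneg (deriv g ((u:ℂ)^4 * x))
    nlinarith
  · exact intervalIntegrable_const
  · refine Filter.Eventually.of_forall fun u hu x hx => ?_
    rw [Set.uIoc_of_le zero_le_one] at hu
    have hw := scale_mem_ball (hsub' hx) ⟨hu.1.le, hu.2⟩
    have h1 : HasDerivAt g (deriv g ((u:ℂ)^4 * x)) ((u:ℂ)^4 * x) :=
      (hg.differentiableAt (isOpen_ball.mem_nhds hw)).hasDerivAt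
    have h2 : HasDerivAt (fun v : ℂ => (u:ℂ)^4 * v) ((u:ℂ)^4) x := by
      simpa using (hasDerivAt_id x).const_mul ((u:ℂ)^4)
    have h3 := (HasDerivAt.comp x (h₂ := g) (h := fun v : ℂ => (u:ℂ)^4 * v) h1 h2).const_mul
      ((u:ℂ)^(m+1))
    refine HasDerivAt.congr_deriv h3 ?_
    ring

lemma scale_ode {r : ℝ} {g : ℂ → ℂ} (hg : DifferentiableOn ℂ g (ball 0 r)) (m : ℕ)
    {z : ℂ} (hz : z ∈ ball (0:ℂ) r) :
    4 * z * (∫ u in (0:ℝ)..1, (u:ℂ)^(m+5) * deriv g ((u:ℂ)^4 * z))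
      + ((m:ℂ)+2) * (∫ u in (0:ℝ)..1, (u:ℂ)^(m+1) * g ((u:ℂ)^4 * z)) = g z := by
  have hd := hg.deriv isOpen_ball
  rw [← integral_const_mul, ← integral_const_mul, ← integral_add, ← scale_ftc hg m hz]
  · congr 1
    ext u
    ring
  · exact (scale_continuousOn hd.continuousOn (m+5) hz).intervalIntegrable.const_mul _
  · exact (scale_continuousOn hg.continuousOn (m+1) hz).intervalIntegrable.const_mul _

/-- The right-hand side operator. -/
noncomputable def pdeRhs (F : ℂ → ℂ) (n : ℕ) (p q : ℂ → ℂ) (w : ℂ) : ℂ :=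
  -(deriv (deriv p) w) + 2 * (n : ℂ) * deriv q w + F w * p w

/-- The coefficients. -/
noncomputable def pdeCoef (F h : ℂ → ℂ) : ℕ → ℂ → ℂ
  | 0 => fun _ => 1
  | 1 => h
  | n + 2 => fun z => (1/((n : ℂ) + 1)) *
      ∫ u in (0:ℝ)..1, (u : ℂ)^(n + 1) *
        pdeRhs F n (pdeCoef F h n) (pdeCoef F h (n+1)) ((u:ℂ)^4 * z)

lemma pdeRhs_diff {r : ℝ} {F p q : ℂ → ℂ} (hF : DifferentiableOn ℂ F (ball 0 r))
    (hp : DifferentiableOn ℂ p (ball 0 r)) (hq : DifferentiableOn ℂ q (ball 0 r)) (n : ℕ) :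
    DifferentiableOn ℂ (pdeRhs F n p q) (ball 0 r) :=
  ((((hp.deriv isOpen_ball).deriv isOpen_ball).neg).add
    ((hq.deriv isOpen_ball).const_mul (2 * (n:ℂ)))).add (hF.mul hp)

lemma pdeRhs_congr {r : ℝ} {F p q p' q' : ℂ → ℂ} (hp : Set.EqOn p p' (ball 0 r))
    (hq : Set.EqOn q q' (ball 0 r)) (n : ℕ) :
    Set.EqOn (pdeRhs F n p q) (pdeRhs F n p' q') (ball 0 r) := by
  intro w hw
  have h1 := hp.deriv isOpen_ball
  have h2 := h1.deriv isOpen_ball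
  have h3 := hq.deriv isOpen_ball
  simp only [pdeRhs]
  rw [h2 hw, h3 hw, hp hw]

lemma pdeCoef_diff {r : ℝ} {F h : ℂ → ℂ} (hF : DifferentiableOn ℂ F (ball 0 r))
    (hh : DifferentiableOn ℂ h (ball 0 r)) (n : ℕ) :
    DifferentiableOn ℂ (pdeCoef F h n) (ball 0 r) ∧
    DifferentiableOn ℂ (pdeCoef F h (n+1)) (ball 0 r) := by
  induction n with
  | zero => exact ⟨by simp only [pdeCoef]; fun_prop, by simpa only [pdeCoef] using hh⟩
  | succ n ih =>
    refine ⟨ih.2, fun z hz => ?_⟩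
    have := (scale_hasDerivAt (pdeRhs_diff hF ih.1 ih.2 n) n hz).const_mul (1/((n : ℂ) + 1))
    simp only [pdeCoef]
    exact this.differentiableAt.differentiableWithinAt

/-- Existence and uniqueness of the sequence `(a_n)` of holomorphic coefficients of the
formal solution of the singular PDE, with `a_0 ≡ 1`, `a_1 = h`, the transport ODEs,
and the integral representation of `a_n` for `n ≥ 2` (here indexed as `a_{n+2}`). -/
theorem singular_pde_formal_coefficients (r : ℝ) (hr : 0 < r) (F h : ℂ → ℂ)
    (hF : DifferentiableOn ℂ F (Metric.ball 0 r))
    (hh : DifferentiableOn ℂ h (Metric.ball 0 r)) :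
    ∃ a : ℕ → ℂ → ℂ,
      (∀ n, DifferentiableOn ℂ (a n) (Metric.ball 0 r)) ∧
      (∀ z ∈ Metric.ball (0 : ℂ) r, a 0 z = 1) ∧
      (∀ z ∈ Metric.ball (0 : ℂ) r, a 1 z = h z) ∧
      (∀ n : ℕ, ∀ z ∈ Metric.ball (0 : ℂ) r,
        4 * z * deriv (a (n + 2)) z + ((n : ℂ) + 2) * a (n + 2) z
          = (1/((n : ℂ) + 1)) *
              (-(deriv (deriv (a n)) z) + 2 * (n : ℂ) * deriv (a (n + 1)) z + F z * a n z)) ∧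
      (∀ n : ℕ, ∀ z ∈ Metric.ball (0 : ℂ) r,
        a (n + 2) z = (1/((n : ℂ) + 1)) *
          ∫ u in (0:ℝ)..1, (u : ℂ)^(n + 1) *
            (-(deriv (deriv (a n)) ((u : ℂ)^4 * z))
              + 2 * (n : ℂ) * deriv (a (n + 1)) ((u : ℂ)^4 * z)
              + F ((u : ℂ)^4 * z) * a n ((u : ℂ)^4 * z))) ∧
      (∀ b : ℕ → ℂ → ℂ,
        (∀ n, DifferentiableOn ℂ (b n) (Metric.ball 0 r)) →
        (∀ z ∈ Metric.ball (0 : ℂ) r, b 0 z = 1) →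
        (∀ z ∈ Metric.ball (0 : ℂ) r, b 1 z = h z) →
        (∀ n : ℕ, ∀ z ∈ Metric.ball (0 : ℂ) r,
          4 * z * deriv (b (n + 2)) z + ((n : ℂ) + 2) * b (n + 2) z
            = (1/((n : ℂ) + 1)) *
                (-(deriv (deriv (b n)) z) + 2 * (n : ℂ) * deriv (b (n + 1)) z + F z * b n z)) →
        ∀ n : ℕ, ∀ z ∈ Metric.ball (0 : ℂ) r, b n z = a n z) := by
  have hd := fun n => (pdeCoef_diff hF hh n).1
  refine ⟨pdeCoef F h, hd, fun z _ => by simp only [pdeCoef], fun z _ => by simp only [pdeCoef],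
    ?_, ?_, ?_⟩
  · intro n z hz
    have hg := pdeRhs_diff hF (hd n) (hd (n+1)) n
    have h1 := (scale_hasDerivAt hg n hz).const_mul (1/((n : ℂ) + 1))
    have h2 := scale_ode hg n hz
    have h3 : deriv (pdeCoef F h (n+2)) z = _ := h1.deriv
    rw [h3]
    have h4 : pdeCoef F h (n+2) z = (1/((n : ℂ) + 1)) *
      ∫ u in (0:ℝ)..1, (u : ℂ)^(n + 1) *
        pdeRhs F n (pdeCoef F h n) (pdeCoef F h (n+1)) ((u:ℂ)^4 * z) := by simp only [pdeCoef]
    rw [h4]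
    change _ = (1/((n : ℂ) + 1)) * pdeRhs F n (pdeCoef F h n) (pdeCoef F h (n+1)) z
    rw [← h2]
    ring
  · intro n z hz
    rw [pdeCoef]
    rfl
  · intro b hb hb0 hb1 hode n
    have key : ∀ n, Set.EqOn (b n) (pdeCoef F h n) (ball 0 r) ∧
        Set.EqOn (b (n+1)) (pdeCoef F h (n+1)) (ball 0 r) := by
      intro n
      induction n with
      | zero => exact ⟨fun z hz => by simp only [pdeCoef]; exact hb0 z hz,
          fun z hz => by simp only [pdeCoef]; exact hb1 z hz⟩
      | succ n ih =>
        refine ⟨ih.2, fun z hz => ?_⟩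
        have hc := pdeRhs_congr (F := F) ih.1 ih.2 n
        rw [← scale_ftc (hb (n+1+1)) n hz]
        simp only [pdeCoef]
        rw [← integral_const_mul]
        apply integral_congr
        intro u hu
        rw [Set.uIcc_of_le zero_le_one] at hu
        have hw := scale_mem_ball hz hu
        have e := hode n _ hw
        have e2 := hc hw
        simp only [pdeRhs] at e2 ⊢
        rw [e2] at e
        rw [e]
        ring
    exact fun z hz => (key n).1 hz
end

section
/- Let r > 0, let F, h be holomorphic on D(0,r), and let (a_n)_{n≥0} be the unique sequence of holomorphic functions on D(0,r) with a_0 ≡ 1, a_1 = h and 4z·a_n' + n·a_n = (1/(n-1))(−a_{n-2}'' + 2(n-2)a_{n-1}' + F·a_{n-2}) for n ≥ 2. Suppose there are 0 < r₁ ≤ r and r₂ > 0 such that the series φ(z,x) := Σ_{n≥0} a_{n+1}(z) x^n converges to a holomorphic function on D(0,r₁) × D(0,r₂). Then for all (z,x) ∈ D(0,r₁) × D(0,r₂): φ(z,x) = h(z) + x·∫₀¹ u·F(z u⁴) du + 2x·∫₀¹ u·∂₁φ(z u⁴, u x) du − ∫₀¹ ( ∫_{[0,ux]} ( t·∂₁²φ(z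 u⁴, t) + 2·∂₁φ(z u⁴, t) − t·F(z u⁴)·φ(z u⁴, t) ) dt ) du, where ∂₁ denotes the partial derivative in the first (z) variable and ∫_{[0,ux]} is the integral along the straight segment from 0 to ux in ℂ. -/
open Complex Metric intervalIntegral

/-- Locally uniform geometric bounds for a family of coefficient functions. -/
def GeomBdd (r₁ r₂ : ℝ) (f : ℕ → ℂ → ℂ) : Prop :=
  ∀ R₁ < r₁, ∀ R₂ < r₂, 0 < R₂ → ∃ C : ℝ, ∀ n w, ‖w‖ ≤ R₁ → ‖f n w‖ * R₂ ^ n ≤ C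

lemma coeff_unique {c d : ℕ → ℂ} {g : ℂ → ℂ} {R : ℝ} (hR : 0 < R)
    (hc : ∀ x ∈ ball (0:ℂ) R, HasSum (fun n => c n * x ^ n) (g x))
    (hd : ∀ x ∈ ball (0:ℂ) R, HasSum (fun n => d n * x ^ n) (g x)) : c = d := by
  have key : ∀ e : ℕ → ℂ, (∀ x ∈ ball (0:ℂ) R, HasSum (fun n => e n * x ^ n) (g x)) →
      HasFPowerSeriesAt g (FormalMultilinearSeries.ofScalars ℂ e) 0 := by
    intro e he
    rw [hasFPowerSeriesAt_iff]
    filter_upwards [ball_mem_nhds (0:ℂ) hR] with x hx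
    simpa [FormalMultilinearSeries.coeff_ofScalars, mul_comm] using he x hx
  have h := (key c hc).eq_formalMultilinearSeries (key d hd)
  funext n
  have := congrArg (fun p => FormalMultilinearSeries.coeff p n) h
  simpa [FormalMultilinearSeries.coeff_ofScalars] using this

lemma geomBdd_of_hasSum {r₁ r₂ : ℝ} (hr₂ : 0 < r₂) {f : ℕ → ℂ → ℂ} {φ : ℂ → ℂ → ℂ}
    (hφ : DifferentiableOn ℂ (fun p : ℂ × ℂ => φ p.1 p.2) (ball 0 r₁ ×ˢ ball 0 r₂))
    (hsum : ∀ z ∈ ball (0 : ℂ) r₁, ∀ x ∈ ball (0 : ℂ) r₂,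
      HasSum (fun n : ℕ => f n z * x^n) (φ z x)) : GeomBdd r₁ r₂ f := by
  intro R₁ h1 R₂ h2 h2p
  have hcpt : IsCompact (closedBall (0:ℂ) R₁ ×ˢ closedBall (0:ℂ) R₂) :=
    (isCompact_closedBall _ _).prod (isCompact_closedBall _ _)
  obtain ⟨C, hC⟩ := hcpt.exists_bound_of_continuousOn (hφ.continuousOn.mono
    (Set.prod_mono (closedBall_subset_ball h1) (closedBall_subset_ball h2)))
  refine ⟨C, fun n w hw => ?_⟩
  have hwb : w ∈ ball (0:ℂ) r₁ := by simpa using lt_of_le_of_lt hw h1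
  have hd : DifferentiableOn ℂ (φ w) (ball 0 r₂) := by
    have : DifferentiableOn ℂ (fun y : ℂ => (w, y)) (ball 0 r₂) := by fun_prop
    exact hφ.comp this (fun y hy => ⟨hwb, hy⟩)
  have ht := Complex.hasSum_taylorSeries_on_ball hd
  have hco : (fun n => f n w) = fun n => ((n.factorial : ℂ))⁻¹ * iteratedDeriv n (φ w) 0 := by
    apply coeff_unique hr₂ (hsum w hwb)
    intro x hx
    have h := ht hx
    simp only [sub_zero, smul_eq_mul] at h
    have e : (fun n : ℕ => ((n.factorial : ℂ))⁻¹ * iteratedDeriv n (φ w) 0 * x ^ n)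
        = fun n : ℕ => ((n.factorial : ℂ))⁻¹ * (x ^ n * iteratedDeriv n (φ w) 0) := by
      funext n; ring
    rw [e]
    exact h
  have hb := Complex.norm_iteratedDeriv_le_of_forall_mem_sphere_norm_le (f := φ w) (c := 0)
    (R := R₂) (C := C) n h2p ?_ ?_
  · have := congrFun hco n
    rw [this, norm_mul, norm_inv, Complex.norm_natCast]
    have hf : (0:ℝ) < n.factorial := by exact_mod_cast n.factorial_pos
    have hp : 0 < R₂ ^ n := pow_pos h2p n
    rw [le_div_iff₀ hp] at hb
    rw [mul_assoc, inv_mul_le_iff₀ hf]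
    exact hb
  · exact (hd.mono (closedBall_subset_ball h2)).diffContOnCl_ball subset_rfl
  · intro y hy
    exact hC (w, y) ⟨by simpa using hw, sphere_subset_closedBall hy⟩

lemma GeomBdd.deriv' {r₁ r₂ : ℝ} {f : ℕ → ℂ → ℂ} (hf : GeomBdd r₁ r₂ f)
    (hd : ∀ n, DifferentiableOn ℂ (f n) (ball 0 r₁)) :
    GeomBdd r₁ r₂ (fun n => deriv (f n)) := by
  intro R₁ h1 R₂ h2 h2p
  set R := (R₁ + r₁) / 2 with hR
  obtain ⟨C, hC⟩ := hf R (by linarith) R₂ h2 h2p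
  refine ⟨C / (R - R₁), fun n w hw => ?_⟩
  have hp : 0 < R₂ ^ n := pow_pos h2p n
  have hsub : closedBall w (R - R₁) ⊆ closedBall 0 R := by
    apply closedBall_subset_closedBall'
    simp; linarith
  have := Complex.norm_deriv_le_of_forall_mem_sphere_norm_le (f := f n) (c := w)
    (R := R - R₁) (C := C / R₂ ^ n) (by linarith) ?_ ?_
  · rw [div_right_comm, le_div_iff₀ hp] at this
    exact this
  · exact ((hd n).mono (hsub.trans (closedBall_subset_ball (by linarith)))).diffContOnCl_ball
      subset_rfl
  · intro y hy
    rw [le_div_iff₀ hp]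
    exact hC n y (by simpa using hsub (sphere_subset_closedBall hy))

lemma GeomBdd.bound {r₁ r₂ : ℝ} {f : ℕ → ℂ → ℂ} (hf : GeomBdd r₁ r₂ f)
    {R₁ R₂ : ℝ} (h1 : R₁ < r₁) (h2 : R₂ < r₂) (h2p : 0 ≤ R₂) :
    ∃ b : ℕ → ℝ, Summable b ∧ ∀ n w y, ‖w‖ ≤ R₁ → ‖y‖ ≤ R₂ → ‖f n w * y ^ n‖ ≤ b n := by
  set R := (R₂ + r₂) / 2 with hR
  have hRp : 0 < R := by linarith
  obtain ⟨C, hC⟩ := hf R₁ h1 R (by linarith) hRp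
  refine ⟨fun n => C * (R₂ / R) ^ n, ?_, fun n w y hw hy => ?_⟩
  · apply Summable.mul_left
    apply summable_geometric_of_lt_one (by positivity)
    rw [div_lt_one hRp]; linarith
  · have h := hC n w hw
    have hp : 0 < R ^ n := pow_pos hRp n
    change _ ≤ C * (R₂ / R) ^ n
    rw [norm_mul, norm_pow, div_pow, ← mul_div_assoc, le_div_iff₀ hp]
    calc ‖f n w‖ * ‖y‖ ^ n * R ^ n = (‖f n w‖ * R ^ n) * ‖y‖ ^ n := by ring
      _ ≤ C * R₂ ^ n := by
        apply mul_le_mul h (by gcongr) (by positivity)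
        exact le_trans (by positivity) h

lemma GeomBdd.hasSum_deriv {r₁ r₂ : ℝ} {f : ℕ → ℂ → ℂ} (hf : GeomBdd r₁ r₂ f)
    (hd : ∀ n, DifferentiableOn ℂ (f n) (ball 0 r₁)) {y : ℂ} (hy : y ∈ ball (0:ℂ) r₂)
    {g : ℂ → ℂ} (hg : ∀ w ∈ ball (0:ℂ) r₁, HasSum (fun n => f n w * y ^ n) (g w)) :
    ∀ w ∈ ball (0:ℂ) r₁, HasSum (fun n => deriv (f n) w * y ^ n) (deriv g w) := by
  intro w hw
  have hw' : ‖w‖ < r₁ := by simpa using hw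
  have hy' : ‖y‖ < r₂ := by simpa using hy
  set R := (‖w‖ + r₁) / 2 with hR
  obtain ⟨b, hb, hbd⟩ := hf.bound (R₁ := R) (by linarith) hy' (norm_nonneg _)
  have hsub : ball (0:ℂ) R ⊆ ball 0 r₁ := ball_subset_ball (by linarith)
  have hwR : w ∈ ball (0:ℂ) R := by simp; linarith
  have := Complex.hasSum_deriv_of_summable_norm (F := fun n w => f n w * y ^ n) (U := ball 0 R)
    hb (fun n => ((hd n).mono hsub).mul_const _) isOpen_ball
    (fun n v hv => hbd n v y (by simpa using (mem_ball_zero_iff.1 hv).le) le_rfl) hwR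
  have e : deriv (fun w => ∑' n, f n w * y ^ n) w = deriv g w := by
    apply Filter.EventuallyEq.deriv_eq
    filter_upwards [isOpen_ball.mem_nhds hw] with v hv using (hg v hv).tsum_eq
  rw [e] at this
  have e2 : (fun n => deriv (f n) w * y ^ n) = fun n => deriv (fun w => f n w * y ^ n) w := by
    funext n
    rw [deriv_mul_const]
    exact (hd n).differentiableAt (isOpen_ball.mem_nhds hw)
  rw [e2]
  exact this

lemma hasSum_integral_unit {c : ℕ → ℝ → ℂ} {g : ℝ → ℂ} {b : ℕ → ℝ}
    (hc : ∀ n, ContinuousOn (c n) (Set.Icc 0 1)) (hb : Summable b)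
    (hbd : ∀ n, ∀ u ∈ Set.Icc (0:ℝ) 1, ‖c n u‖ ≤ b n)
    (hs : ∀ u ∈ Set.Icc (0:ℝ) 1, HasSum (fun n => c n u) (g u)) :
    HasSum (fun n => ∫ u in (0:ℝ)..1, c n u) (∫ u in (0:ℝ)..1, g u) := by
  have hI : ∀ t : ℝ, t ∈ Set.uIoc (0:ℝ) 1 → t ∈ Set.Icc (0:ℝ) 1 := by
    intro t ht
    rw [Set.uIoc_of_le zero_le_one] at ht
    exact ⟨ht.1.le, ht.2⟩
  apply intervalIntegral.hasSum_integral_of_dominated_convergence (fun n _ => b n)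
  · intro n
    apply ((hc n).mono hI).aestronglyMeasurable measurableSet_uIoc
  · exact fun n => Filter.Eventually.of_forall fun t ht => hbd n t (hI t ht)
  · exact Filter.Eventually.of_forall fun t ht => hb
  · exact intervalIntegrable_const
  · exact Filter.Eventually.of_forall fun t ht => hs t (hI t ht)

lemma u4z_mem {z : ℂ} {u : ℝ} (hu : u ∈ Set.Icc (0:ℝ) 1) : ‖(u:ℂ)^4 * z‖ ≤ ‖z‖ := by
  rw [norm_mul, norm_pow, Complex.norm_real, Real.norm_of_nonneg hu.1]
  exact mul_le_of_le_one_left (norm_nonneg _) (pow_le_one₀ hu.1 hu.2)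

lemma ux_mem {x : ℂ} {u : ℝ} (hu : u ∈ Set.Icc (0:ℝ) 1) : ‖(u:ℂ) * x‖ ≤ ‖x‖ := by
  rw [norm_mul, Complex.norm_real, Real.norm_of_nonneg hu.1]
  exact mul_le_of_le_one_left (norm_nonneg _) hu.2

lemma contOn_u4 {r : ℝ} {f : ℂ → ℂ} (hf : ContinuousOn f (ball 0 r)) {z : ℂ}
    (hz : z ∈ ball (0:ℂ) r) :
    ContinuousOn (fun u : ℝ => f ((u:ℂ)^4 * z)) (Set.Icc 0 1) := by
  apply hf.comp (by fun_prop)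
  intro u hu
  have := u4z_mem (z := z) hu
  simp only [mem_ball_zero_iff] at hz ⊢
  linarith

lemma euler_ode {r : ℝ} {f g : ℂ → ℂ} (hf : DifferentiableOn ℂ f (ball 0 r)) (m : ℕ)
    (hg : ContinuousOn g (ball 0 r))
    (hode : ∀ z ∈ ball (0:ℂ) r, 4 * z * deriv f z + ((m:ℂ) + 1) * f z = g z)
    {z : ℂ} (hz : z ∈ ball (0:ℂ) r) :
    f z = ∫ u in (0:ℝ)..1, (u:ℂ)^m * g ((u:ℂ)^4 * z) := by
  have hD : ∀ u ∈ Set.uIcc (0:ℝ) 1, HasDerivAt (fun u : ℝ => (u:ℂ)^(m+1) * f ((u:ℂ)^4 * z))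
      ((u:ℂ)^m * g ((u:ℂ)^4 * z)) u := by
    intro u hu
    rw [Set.uIcc_of_le zero_le_one] at hu
    have hm : (u:ℂ)^4 * z ∈ ball (0:ℂ) r := by
      have := u4z_mem (z := z) hu
      simp only [mem_ball_zero_iff] at hz ⊢
      linarith
    have h1 : HasDerivAt f (deriv f ((u:ℂ)^4*z)) ((u:ℂ)^4*z) :=
      (hf.differentiableAt (isOpen_ball.mem_nhds hm)).hasDerivAt
    have h2 : HasDerivAt (fun v : ℂ => v^4 * z) (4 * (u:ℂ)^3 * z) (u:ℂ) := by
      simpa using (hasDerivAt_pow 4 (u:ℂ)).mul_const z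
    have h3 : HasDerivAt (fun v : ℂ => v^(m+1)) (((m:ℂ)+1) * (u:ℂ)^m) (u:ℂ) := by
      simpa using (hasDerivAt_pow (m+1) (u:ℂ))
    have h4 := (h3.mul (HasDerivAt.comp (u:ℂ) h1 h2)).comp_ofReal
    refine HasDerivAt.congr_deriv h4 ?_
    rw [← hode _ hm]
    simp only [Function.comp]
    ring
  have hi : IntervalIntegrable (fun u : ℝ => (u:ℂ)^m * g ((u:ℂ)^4 * z)) MeasureTheory.volume 0 1 := by
    apply ContinuousOn.intervalIntegrable
    rw [Set.uIcc_of_le zero_le_one]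
    exact ContinuousOn.mul (by fun_prop) (contOn_u4 hg hz)
  rw [intervalIntegral.integral_eq_sub_of_hasDerivAt hD hi]
  simp

/-- If the series `φ(z,x) = Σ a_{n+1}(z) x^n` built from the formal coefficients `a_n`
converges to a holomorphic function on a polydisk, then `φ` satisfies the fixed-point
integral equation (segments `∫_{[0,ux]}` are parametrized by `t = s·u·x`, `s ∈ [0,1]`). -/
theorem singular_pde_integral_equation (r : ℝ) (hr : 0 < r) (F h : ℂ → ℂ)
    (hF : DifferentiableOn ℂ F (Metric.ball 0 r))
    (hh : DifferentiableOn ℂ h (Metric.ball 0 r))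
    (a : ℕ → ℂ → ℂ)
    (ha : ∀ n, DifferentiableOn ℂ (a n) (Metric.ball 0 r))
    (ha0 : ∀ z ∈ Metric.ball (0 : ℂ) r, a 0 z = 1)
    (ha1 : ∀ z ∈ Metric.ball (0 : ℂ) r, a 1 z = h z)
    (harec : ∀ n : ℕ, ∀ z ∈ Metric.ball (0 : ℂ) r,
      4 * z * deriv (a (n + 2)) z + ((n : ℂ) + 2) * a (n + 2) z
        = (1/((n : ℂ) + 1)) *
            (-(deriv (deriv (a n)) z) + 2 * (n : ℂ) * deriv (a (n + 1)) z + F z * a n z))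
    (r₁ r₂ : ℝ) (hr₁ : 0 < r₁) (hr₁r : r₁ ≤ r) (hr₂ : 0 < r₂)
    (φ : ℂ → ℂ → ℂ)
    (hφ : DifferentiableOn ℂ (fun p : ℂ × ℂ => φ p.1 p.2)
      (Metric.ball 0 r₁ ×ˢ Metric.ball 0 r₂))
    (hφsum : ∀ z ∈ Metric.ball (0 : ℂ) r₁, ∀ x ∈ Metric.ball (0 : ℂ) r₂,
      HasSum (fun n : ℕ => a (n + 1) z * x^n) (φ z x)) :
    ∀ z ∈ Metric.ball (0 : ℂ) r₁, ∀ x ∈ Metric.ball (0 : ℂ) r₂,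
      φ z x = h z
        + x * (∫ u in (0:ℝ)..1, (u : ℂ) * F ((u : ℂ)^4 * z))
        + 2 * x * (∫ u in (0:ℝ)..1,
            (u : ℂ) * deriv (fun w => φ w ((u : ℂ) * x)) ((u : ℂ)^4 * z))
        - ∫ u in (0:ℝ)..1, ((u : ℂ) * x) *
            ∫ s in (0:ℝ)..1,
              (((s : ℂ) * ((u : ℂ) * x)) *
                  deriv (deriv (fun w => φ w ((s : ℂ) * ((u : ℂ) * x)))) ((u : ℂ)^4 * z)
                + 2 * deriv (fun w => φ w ((s : ℂ) * ((u : ℂ) * x))) ((u : ℂ)^4 * z)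
                - ((s : ℂ) * ((u : ℂ) * x)) * F ((u : ℂ)^4 * z) *
                    φ ((u : ℂ)^4 * z) ((s : ℂ) * ((u : ℂ) * x))) := by
  intro z hz x hx
  have hzn : ‖z‖ < r₁ := by simpa using hz
  have hxn : ‖x‖ < r₂ := by simpa using hx
  have hzr : z ∈ ball (0:ℂ) r := ball_subset_ball hr₁r hz
  have hsub : ball (0:ℂ) r₁ ⊆ ball 0 r := ball_subset_ball hr₁r
  have hda : ∀ n, DifferentiableOn ℂ (deriv (a n)) (ball 0 r) := fun n => (ha n).deriv isOpen_ball
  have hdda : ∀ n, DifferentiableOn ℂ (deriv (deriv (a n))) (ball 0 r) :=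
    fun n => (hda n).deriv isOpen_ball
  have hd0 : ∀ n, DifferentiableOn ℂ (a (n+1)) (ball 0 r₁) := fun n => (ha _).mono hsub
  have hd1 : ∀ n, DifferentiableOn ℂ (deriv (a (n+1))) (ball 0 r₁) := fun n => (hda _).mono hsub
  have B0 : GeomBdd r₁ r₂ (fun n => a (n+1)) := geomBdd_of_hasSum hr₂ hφ hφsum
  have B1 : GeomBdd r₁ r₂ (fun n => deriv (a (n+1))) := B0.deriv' hd0
  have B2 : GeomBdd r₁ r₂ (fun n => deriv (deriv (a (n+1)))) := B1.deriv' hd1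
  have S1 : ∀ y ∈ ball (0:ℂ) r₂, ∀ w ∈ ball (0:ℂ) r₁,
      HasSum (fun n => deriv (a (n+1)) w * y ^ n) (deriv (fun w => φ w y) w) :=
    fun y hy => B0.hasSum_deriv hd0 hy (fun w hw => hφsum w hw y hy)
  have S2 : ∀ y ∈ ball (0:ℂ) r₂, ∀ w ∈ ball (0:ℂ) r₁,
      HasSum (fun n => deriv (deriv (a (n+1))) w * y ^ n) (deriv (deriv (fun w => φ w y)) w) :=
    fun y hy => B1.hasSum_deriv hd1 hy (S1 y hy)
  obtain ⟨b0, hb0, hbd0⟩ := B0.bound hzn hxn (norm_nonneg _)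
  obtain ⟨b1, hb1, hbd1⟩ := B1.bound hzn hxn (norm_nonneg _)
  obtain ⟨b2, hb2, hbd2⟩ := B2.bound hzn hxn (norm_nonneg _)
  have cF := contOn_u4 hF.continuousOn hzr
  have c0 := fun n => contOn_u4 (ha n).continuousOn hzr
  have c1 := fun n => contOn_u4 (hda n).continuousOn hzr
  have c2 := fun n => contOn_u4 (hdda n).continuousOn hzr
  obtain ⟨K, hK⟩ := isCompact_Icc.exists_bound_of_continuousOn cF
  have hwm : ∀ u ∈ Set.Icc (0:ℝ) 1, (u:ℂ)^4 * z ∈ ball (0:ℂ) r₁ := by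
    intro u hu
    simpa using lt_of_le_of_lt (u4z_mem (z := z) hu) hzn
  have hym : ∀ y : ℂ, ‖y‖ ≤ ‖x‖ → y ∈ ball (0:ℂ) r₂ := by
    intro y hy
    simpa using lt_of_le_of_lt hy hxn
  have hint : ∀ f : ℝ → ℂ, ContinuousOn f (Set.Icc 0 1) →
      IntervalIntegrable f MeasureTheory.volume 0 1 := by
    intro f hf
    apply ContinuousOn.intervalIntegrable
    rwa [Set.uIcc_of_le zero_le_one]
  -- the first-derivative term
  have HA := hasSum_integral_unit
    (c := fun n u => (u:ℂ) * (deriv (a (n+1)) ((u:ℂ)^4 * z) * ((u:ℂ) * x)^n))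
    (g := fun u => (u:ℂ) * deriv (fun w => φ w ((u : ℂ) * x)) ((u : ℂ)^4 * z)) (b := b1)
    (fun n => ContinuousOn.mul (by fun_prop) ((c1 (n+1)).mul (by fun_prop))) hb1
    (fun n u hu => by
      rw [norm_mul, Complex.norm_real, Real.norm_of_nonneg hu.1]
      exact (mul_le_of_le_one_left (norm_nonneg _) hu.2).trans
        (hbd1 n _ _ (u4z_mem hu) (ux_mem hu)))
    (fun u hu => (S1 _ (hym _ (ux_mem hu)) _ (hwm u hu)).mul_left _)
  set A : ℕ → ℂ := fun n => ∫ u in (0:ℝ)..1,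
    (u:ℂ) * (deriv (a (n+1)) ((u:ℂ)^4 * z) * ((u:ℂ) * x)^n) with hA
  -- the inner integral
  have hpow : ∀ n : ℕ, ∫ s in (0:ℝ)..1, (s:ℂ)^n = 1 / ((n:ℂ) + 1) := by
    intro n
    have : ∀ s : ℝ, (s:ℂ)^n = ((s^n : ℝ) : ℂ) := fun s => by push_cast; rfl
    simp_rw [this]
    rw [intervalIntegral.integral_ofReal, integral_pow]
    push_cast
    simp
  let G : ℝ → ℂ := fun u => ∫ s in (0:ℝ)..1,
              (((s : ℂ) * ((u : ℂ) * x)) *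
                  deriv (deriv (fun w => φ w ((s : ℂ) * ((u : ℂ) * x)))) ((u : ℂ)^4 * z)
                + 2 * deriv (fun w => φ w ((s : ℂ) * ((u : ℂ) * x))) ((u : ℂ)^4 * z)
                - ((s : ℂ) * ((u : ℂ) * x)) * F ((u : ℂ)^4 * z) *
                    φ ((u : ℂ)^4 * z) ((s : ℂ) * ((u : ℂ) * x)))
  let c : ℝ → ℕ → ℝ → ℂ := fun u n s =>
    ((s : ℂ) * ((u : ℂ) * x)) *
        (deriv (deriv (a (n+1))) ((u : ℂ)^4 * z) * ((s : ℂ) * ((u : ℂ) * x))^n)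
      + 2 * (deriv (a (n+1)) ((u : ℂ)^4 * z) * ((s : ℂ) * ((u : ℂ) * x))^n)
      - ((s : ℂ) * ((u : ℂ) * x)) * F ((u : ℂ)^4 * z) *
          (a (n+1) ((u : ℂ)^4 * z) * ((s : ℂ) * ((u : ℂ) * x))^n)
  let b : ℕ → ℝ := fun n => ‖x‖ * b2 n + 2 * b1 n + ‖x‖ * K * b0 n
  have hb : Summable b := ((hb2.mul_left _).add (hb1.mul_left _)).add (hb0.mul_left _)
  have hcb : ∀ u ∈ Set.Icc (0:ℝ) 1, ∀ n, ∀ s ∈ Set.Icc (0:ℝ) 1, ‖c u n s‖ ≤ b n := by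
    intro u hu n s hs
    have hy : ‖(s : ℂ) * ((u : ℂ) * x)‖ ≤ ‖x‖ := (ux_mem hs).trans (ux_mem hu)
    have e0 := hbd0 n _ _ (u4z_mem (z := z) hu) hy
    have e1 := hbd1 n _ _ (u4z_mem (z := z) hu) hy
    have e2 := hbd2 n _ _ (u4z_mem (z := z) hu) hy
    have eK := hK u hu
    have hK0 : 0 ≤ K := (norm_nonneg _).trans eK
    refine (norm_sub_le _ _).trans (add_le_add ((norm_add_le _ _).trans (add_le_add ?_ ?_)) ?_)
    · rw [norm_mul]
      exact mul_le_mul hy e2 (norm_nonneg _) (norm_nonneg _)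
    · rw [norm_mul, Complex.norm_ofNat]
      exact mul_le_mul_of_nonneg_left e1 (by norm_num)
    · rw [norm_mul, norm_mul]
      exact mul_le_mul (mul_le_mul hy eK (norm_nonneg _) (norm_nonneg _)) e0 (norm_nonneg _)
        (by positivity)
  have hcs : ∀ u ∈ Set.Icc (0:ℝ) 1, ∀ s ∈ Set.Icc (0:ℝ) 1, HasSum (fun n => c u n s)
      (((s : ℂ) * ((u : ℂ) * x)) *
                  deriv (deriv (fun w => φ w ((s : ℂ) * ((u : ℂ) * x)))) ((u : ℂ)^4 * z)
                + 2 * deriv (fun w => φ w ((s : ℂ) * ((u : ℂ) * x))) ((u : ℂ)^4 * z)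
                - ((s : ℂ) * ((u : ℂ) * x)) * F ((u : ℂ)^4 * z) *
                    φ ((u : ℂ)^4 * z) ((s : ℂ) * ((u : ℂ) * x))) := by
    intro u hu s hs
    have hy := hym _ ((ux_mem hs).trans (ux_mem (x := x) hu))
    have hw := hwm u hu
    exact (((S2 _ hy _ hw).mul_left _).add ((S1 _ hy _ hw).mul_left _)).sub
      ((hφsum _ hw _ hy).mul_left _)
  have HG : ∀ u ∈ Set.Icc (0:ℝ) 1, HasSum (fun n => ∫ s in (0:ℝ)..1, c u n s) (G u) := by
    intro u hu
    exact hasSum_integral_unit (fun n => by dsimp only [c]; fun_prop) hb (hcb u hu) (hcs u hu)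
  have hcint : ∀ u : ℝ, ∀ n, ∫ s in (0:ℝ)..1, c u n s =
      ((u:ℂ)*x)^(n+1) * (deriv (deriv (a (n+1))) ((u : ℂ)^4 * z)
        - F ((u : ℂ)^4 * z) * a (n+1) ((u : ℂ)^4 * z)) / ((n:ℂ)+2)
      + 2 * deriv (a (n+1)) ((u : ℂ)^4 * z) * ((u:ℂ)*x)^n / ((n:ℂ)+1) := by
    intro u n
    have e : ∀ s : ℝ, c u n s =
      (((u:ℂ)*x)^(n+1) * (deriv (deriv (a (n+1))) ((u : ℂ)^4 * z)
        - F ((u : ℂ)^4 * z) * a (n+1) ((u : ℂ)^4 * z))) * (s:ℂ)^(n+1)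
      + (2 * deriv (a (n+1)) ((u : ℂ)^4 * z) * ((u:ℂ)*x)^n) * (s:ℂ)^n := by
      intro s
      dsimp only [c]
      ring
    simp_rw [e]
    rw [intervalIntegral.integral_add (hint _ (by fun_prop)) (hint _ (by fun_prop)),
      intervalIntegral.integral_const_mul, intervalIntegral.integral_const_mul, hpow, hpow]
    push_cast
    rw [show (n:ℂ) + 1 + 1 = n + 2 by ring]
    ring
  -- the outer integral
  have HI := hasSum_integral_unit
    (c := fun n u => ((u:ℂ) * x) * ∫ s in (0:ℝ)..1, c u n s)
    (g := fun u => ((u:ℂ) * x) * G u) (b := fun n => ‖x‖ * b n)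
    (fun n => by
      simp_rw [hcint]
      refine ContinuousOn.mul (by fun_prop) (ContinuousOn.add ?_ ?_)
      · exact (ContinuousOn.mul (by fun_prop) ((c2 _).sub (cF.mul (c0 _)))).div_const _
      · exact ((continuousOn_const.mul (c1 _)).mul (by fun_prop)).div_const _)
    (hb.mul_left _)
    (fun n u hu => by
      rw [norm_mul]
      refine mul_le_mul (ux_mem hu) ?_ (norm_nonneg _) (norm_nonneg _)
      have := intervalIntegral.norm_integral_le_of_norm_le_const (a := 0) (b := 1)
        (f := c u n) (C := b n) (fun s hs => by
          rw [Set.uIoc_of_le zero_le_one] at hs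
          exact hcb u hu n s ⟨hs.1.le, hs.2⟩)
      simpa using this)
    (fun u hu => (HG u hu).mul_left _)
  let E : ℕ → ℂ := fun n => ∫ u in (0:ℝ)..1, ((u:ℂ)*x)^(n+1) * (deriv (deriv (a n)) ((u : ℂ)^4 * z)
        - F ((u : ℂ)^4 * z) * a n ((u : ℂ)^4 * z)) / ((n:ℂ)+1)
  have hEc : ∀ n, ContinuousOn (fun u : ℝ => ((u:ℂ)*x)^(n+1) *
      (deriv (deriv (a n)) ((u : ℂ)^4 * z)
        - F ((u : ℂ)^4 * z) * a n ((u : ℂ)^4 * z)) / ((n:ℂ)+1)) (Set.Icc 0 1) := fun n =>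
    (ContinuousOn.mul (by fun_prop) ((c2 _).sub (cF.mul (c0 _)))).div_const _
  have hAc : ∀ n, ContinuousOn (fun u : ℝ =>
      (u:ℂ) * (deriv (a (n+1)) ((u:ℂ)^4 * z) * ((u:ℂ) * x)^n)) (Set.Icc 0 1) := fun n =>
    ContinuousOn.mul (by fun_prop) ((c1 (n+1)).mul (by fun_prop))
  have hAk : ∀ (k : ℂ) (n : ℕ), ContinuousOn (fun u : ℝ =>
      k * ((u:ℂ) * (deriv (a (n+1)) ((u:ℂ)^4 * z) * ((u:ℂ) * x)^n))) (Set.Icc 0 1) := fun k n =>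
    continuousOn_const.mul (hAc n)
  have hIn : ∀ n, ∫ u in (0:ℝ)..1, ((u:ℂ) * x) * ∫ s in (0:ℝ)..1, c u n s
      = E (n+1) + 2 * x / ((n:ℂ)+1) * A n := by
    intro n
    dsimp only [E]
    rw [hA]
    dsimp only
    rw [← intervalIntegral.integral_const_mul,
      ← intervalIntegral.integral_add (hint _ (hEc (n+1)))
        (hint _ (hAk _ n))]
    congr 1
    funext u
    rw [hcint]
    push_cast
    rw [show (n:ℂ) + 1 + 1 = n + 2 by ring]
    ring
  simp_rw [hIn] at HI
  have hsD : Summable (fun n : ℕ => 2 * x / ((n:ℂ)+1) * A n) := by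
    apply Summable.of_norm_bounded (g := fun n => ‖2 * x‖ * ‖A n‖) (HA.summable.norm.mul_left _)
    intro n
    rw [norm_mul, norm_div]
    refine mul_le_mul_of_nonneg_right (div_le_self (norm_nonneg _) ?_) (norm_nonneg _)
    have : ((n:ℂ)+1) = ((n+1 : ℕ) : ℂ) := by push_cast; rfl
    rw [this, Complex.norm_natCast]
    push_cast
    linarith [Nat.cast_nonneg (α := ℝ) n]
  obtain ⟨t, ht⟩ := hsD
  have HE : HasSum (fun n => E (n+1)) ((∫ u in (0:ℝ)..1, ((u:ℂ) * x) * G u) - t) := by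
    have := HI.sub ht
    simpa using this
  rw [hasSum_nat_add_iff (f := E) 1] at HE
  have HT := ((HA.mul_left (2 * x)).sub ht).sub HE
  have HL := (hasSum_nat_add_iff (f := fun n => a (n+1) z * x^n)
    (g := φ z x - a 1 z) 1).2 (by simpa using hφsum z hz x hx)
  have hterm : (fun n => a (n+1+1) z * x^(n+1)) =
      fun n => 2 * x * A n - 2 * x / ((n:ℂ)+1) * A n - E n := by
    funext n
    have hn1 : (n:ℂ) + 1 ≠ 0 := Nat.cast_add_one_ne_zero n
    have hode := euler_ode (ha (n+2)) (n+1)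
      (g := fun z => (1/((n : ℂ) + 1)) *
            (-(deriv (deriv (a n)) z) + 2 * (n : ℂ) * deriv (a (n + 1)) z + F z * a n z))
      (continuousOn_const.mul (((hdda n).continuousOn.neg.add
        (continuousOn_const.mul (hda (n+1)).continuousOn)).add
        (hF.continuousOn.mul (ha n).continuousOn)))
      (fun z hz => by
        rw [← harec n z hz]
        push_cast
        ring) hzr
    have e1 : 2 * x * A n - 2 * x / ((n:ℂ)+1) * A n = (2 * x * n / ((n:ℂ)+1)) * A n := by
      field_simp
      ring
    rw [e1, hode, hA]
    dsimp only [E]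
    rw [← intervalIntegral.integral_const_mul, ← intervalIntegral.integral_mul_const,
      ← intervalIntegral.integral_sub (hint _ (hAk _ n)) (hint _ (hEc n))]
    congr 1
    funext u
    field_simp
    ring
  have hE0 : E 0 = - (x * ∫ u in (0:ℝ)..1, (u : ℂ) * F ((u : ℂ)^4 * z)) := by
    dsimp only [E]
    rw [← intervalIntegral.integral_const_mul, ← intervalIntegral.integral_neg]
    apply intervalIntegral.integral_congr
    intro u hu
    rw [Set.uIcc_of_le zero_le_one] at hu
    have hw := hsub (hwm u hu)
    have h1 : ∀ w ∈ ball (0:ℂ) r, deriv (a 0) w = 0 := by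
      intro w hw
      have : a 0 =ᶠ[nhds w] fun _ => (1:ℂ) := by
        filter_upwards [isOpen_ball.mem_nhds hw] with v hv using ha0 v hv
      rw [this.deriv_eq]
      simp
    have h2 : deriv (deriv (a 0)) ((u:ℂ)^4 * z) = 0 := by
      have : deriv (a 0) =ᶠ[nhds ((u:ℂ)^4 * z)] fun _ => (0:ℂ) := by
        filter_upwards [isOpen_ball.mem_nhds hw] with v hv using h1 v hv
      rw [this.deriv_eq]
      simp
    simp only [h2, ha0 _ hw]
    push_cast
    ring
  rw [hterm] at HL
  have hfin := HL.unique HT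
  rw [Finset.sum_range_one, hE0, ha1 z hzr] at hfin
  change φ z x = h z + x * (∫ u in (0:ℝ)..1, (u : ℂ) * F ((u : ℂ)^4 * z))
        + 2 * x * (∫ u in (0:ℝ)..1,
            (u : ℂ) * deriv (fun w => φ w ((u : ℂ) * x)) ((u : ℂ)^4 * z))
        - ∫ u in (0:ℝ)..1, ((u : ℂ) * x) * G u
  linear_combination hfin
end
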